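/- For each β > β_c there exists ρ ∈ (0,1) such that the Schonmann projection ν_{β,0}^+ stochastically dominates the i.i.d. product measure π_ρ, while π_ρ is NOT stochastically dominated by ν_{β,0}^− (the projection of the minus phase). -/

import Mathlib

open MeasureTheory Filter Topology ProbabilityTheory

noncomputable section

/-- Spin value of a Boolean spin: `true ↦ +1`, `false ↦ -1`. -/
def sval (b : Bool) : ℝ := if b then 1 else -1

/-- Two-dimensional spin configurations. -/
abbrev Cfg2 := ℤ × ℤ → Bool

/-- Two-sided sequences over an alphabet `A`. -/
abbrev ZSeq (A : Type*) := ℤ → A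

/-- Pasts: index `k` corresponds to the coordinate `-(k+1)`. -/
abbrev Past (A : Type*) := ℕ → A

/-- The four nearest neighbours of a site of `ℤ²`. -/
def nbrs (x : ℤ × ℤ) : Finset (ℤ × ℤ) :=
  {(x.1 + 1, x.2), (x.1 - 1, x.2), (x.1, x.2 + 1), (x.1, x.2 - 1)}

/-- Boltzmann weight
`exp(β[Σ_{{x,y}⊆Λ, x∼y} ω_x ω_y + Σ_{x∈Λ, y∉Λ, x∼y} ω_x σ_y] − h Σ_{x∈Λ} ω_x)`
(the sum over unordered pairs inside `Λ` is written as half the ordered sum). -/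
def isingWeight (β h : ℝ) (Λ : Finset (ℤ × ℤ)) (σ ω : Cfg2) : ℝ :=
  Real.exp (β * ((∑ x ∈ Λ, ∑ y ∈ Λ.filter (fun y => y ∈ nbrs x),
        sval (ω x) * sval (ω y)) / 2
      + ∑ x ∈ Λ, ∑ y ∈ (nbrs x).filter (fun y => y ∉ Λ), sval (ω x) * sval (σ y))
    - h * ∑ x ∈ Λ, sval (ω x))

/-- Fill in the values `τ` inside `Λ` and `σ` outside. -/
def fill (Λ : Finset (ℤ × ℤ)) (σ : Cfg2) (τ : ↥Λ → Bool) : Cfg2 :=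
  fun x => if hx : x ∈ Λ then τ ⟨x, hx⟩ else σ x

/-- The finite-volume Ising measure in `Λ` with boundary condition `σ`, viewed as a measure on
the full configuration space, the spins outside `Λ` being frozen to `σ`. -/
def isingFV (β h : ℝ) (Λ : Finset (ℤ × ℤ)) (σ : Cfg2) : Measure Cfg2 :=
  (∑ τ : ↥Λ → Bool, ENNReal.ofReal (isingWeight β h Λ σ (fill Λ σ τ)))⁻¹ •
    ∑ τ : ↥Λ → Bool,
      ENNReal.ofReal (isingWeight β h Λ σ (fill Λ σ τ)) • Measure.dirac (fill Λ σ τ)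

/-- The box `[-n,n]²`. -/
def box (n : ℕ) : Finset (ℤ × ℤ) :=
  (Finset.Icc (-(n : ℤ)) (n : ℤ)) ×ˢ (Finset.Icc (-(n : ℤ)) (n : ℤ))

/-- Convergence of a sequence of measures on a product space in the sense of convergence of the
measures of all finite-dimensional cylinder events; for probability measures on `{−1,+1}^ι`
this is exactly weak convergence. -/
def CylTendsto {ι A : Type*} [MeasurableSpace A] (μs : ℕ → Measure (ι → A))
    (μ : Measure (ι → A)) : Prop :=
  ∀ (s : Finset ι) (f : ι → A),
    Tendsto (fun n => μs n {η | ∀ i ∈ s, η i = f i}) atTop (𝓝 (μ {η | ∀ i ∈ s, η i = f i}))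

/-- `μ` is the plus phase `μ_{β,h}^+`: the weak limit of the finite-volume Ising measures on
`[-n,n]²` with all-plus boundary conditions. -/
def IsPlusPhase (β h : ℝ) (μ : Measure Cfg2) : Prop :=
  IsProbabilityMeasure μ ∧ CylTendsto (fun n => isingFV β h (box n) (fun _ => true)) μ

/-- `μ` is the minus phase `μ_{β,h}^-`. -/
def IsMinusPhase (β h : ℝ) (μ : Measure Cfg2) : Prop :=
  IsProbabilityMeasure μ ∧ CylTendsto (fun n => isingFV β h (box n) (fun _ => false)) μ

/-- The critical inverse temperature `β_c = ln(1+√2)/2`. -/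
def betaCrit : ℝ := Real.log (1 + Real.sqrt 2) / 2

/-- Projection of a two-dimensional configuration onto the line `ℤ × {0}`. -/
def lineProj (η : Cfg2) : ZSeq Bool := fun i => η (i, 0)

/-- The Schonmann projection of a measure on `{−1,+1}^{ℤ²}`. -/
def schonmann (μ : Measure Cfg2) : Measure (ZSeq Bool) := μ.map lineProj

/-- Restriction of a two-sided sequence to its strict past; index `k` is coordinate `-(k+1)`. -/
def restrictPast {A : Type*} (ω : ZSeq A) : Past A := fun k => ω (-(k + 1 : ℤ))

/-- The shift on two-sided sequences. -/
def shiftSeq {A : Type*} : ZSeq A → ZSeq A := fun ω i => ω (i + 1)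

/-- The σ-algebra `ℱ_{<0}` generated by the coordinates of negative index. -/
def pastSigma (A : Type*) [MeasurableSpace A] : MeasurableSpace (ZSeq A) :=
  MeasurableSpace.comap (fun ω : ZSeq A => restrictPast ω) inferInstance

/-- The σ-algebra generated by the coordinates in `S`. -/
def sigmaOn {ι A : Type*} [MeasurableSpace A] (S : Set ι) : MeasurableSpace (ι → A) :=
  MeasurableSpace.comap (fun ω : ι → A => S.restrict ω) inferInstance

/-- A g-function on the alphabet `A`: measurable, `[0,1]`-valued, normalized. -/
def IsGFunction {A : Type*} [Fintype A] [MeasurableSpace A] (P : A → Past A → ℝ) : Prop :=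
  (∀ a, Measurable (P a)) ∧ ∀ ω, (∑ a : A, P a ω) = 1 ∧ ∀ a, P a ω ∈ Set.Icc (0 : ℝ) 1

/-- `μ` is a translation-invariant g-measure consistent with the g-function `P`: for each `a`,
`ω ↦ P a (restrictPast ω)` is a version of the conditional probability `μ(X₀ = a | ℱ_{<0})`. -/
def IsGMeasure {A : Type*} [MeasurableSpace A] (μ : Measure (ZSeq A))
    (P : A → Past A → ℝ) : Prop :=
  IsProbabilityMeasure μ ∧ μ.map shiftSeq = μ ∧
    ∀ a : A, (fun ω => P a (restrictPast ω))
      =ᵐ[μ] μ[Set.indicator {ω : ZSeq A | ω 0 = a} (fun _ => (1 : ℝ)) | pastSigma A]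

/-- The `k`-th variation of a g-function: the supremum of `|P a ω − P a σ|` over pasts agreeing
on the coordinates `−k,…,−1`. -/
def varG {A : Type*} (P : A → Past A → ℝ) (k : ℕ) : ℝ :=
  sSup {d : ℝ | ∃ (a : A) (ω σ' : Past A), (∀ j < k, ω j = σ' j) ∧ d = |P a ω - P a σ'|}

/-- Elementary conditional probability `μ(B | A)`, as a real number. -/
def condProbR {X : Type*} [MeasurableSpace X] (μ : Measure X) (B A : Set X) : ℝ :=
  ((μ[|A]) B).toReal

/-- The event that `η_i = ω` (suitably reindexed) for `−n ≤ i ≤ −1` and `η_i = b`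
for `−(n+l) ≤ i ≤ −(n+1)`. -/
def pastEvt (n l : ℕ) (b : Bool) (ω : Past Bool) : Set (ZSeq Bool) :=
  {η | (∀ i : ℤ, -(n : ℤ) ≤ i → i ≤ -1 → η i = ω (i.natAbs - 1)) ∧
       (∀ i : ℤ, -((n : ℤ) + l) ≤ i → i ≤ -((n : ℤ) + 1) → η i = b)}

/-- The event that `η_i = b` for `−(n+l) ≤ i ≤ −n`. -/
def blockEvt (n l : ℕ) (b : Bool) : Set (ZSeq Bool) :=
  {η | ∀ i : ℤ, -((n : ℤ) + l) ≤ i → i ≤ -(n : ℤ) → η i = b}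

/-- The event that `η_i = b` for `−n ≤ i ≤ −1`. -/
def allBlock (n : ℕ) (b : Bool) : Set (ZSeq Bool) :=
  {η | ∀ i : ℤ, -(n : ℤ) ≤ i → i ≤ -1 → η i = b}

/-- `P` is the g-function `P^{+,b}` obtained from `ν` by conditioning on the symbol `b`
in the far past: `P(a|ω) = lim_n lim_l ν(η₀ = a | η = b on [−(n+l),−(n+1)], η = ω on [−n,−1])`,
both iterated limits being required to exist. -/
def IsCondG (ν : Measure (ZSeq Bool)) (b : Bool) (P : Bool → Past Bool → ℝ) : Prop :=
  ∀ (a : Bool) (ω : Past Bool), ∃ L : ℕ → ℝ,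
    (∀ n, Tendsto (fun l => condProbR ν {η | η 0 = a} (pastEvt n l b ω)) atTop (𝓝 (L n))) ∧
    Tendsto L atTop (𝓝 (P a ω))

/-- `ν'` is the iterated weak limit `lim_n lim_l ν( · | η = b on [−(n+l),−n])`. -/
def IsCondLimitMeasure (ν : Measure (ZSeq Bool)) (b : Bool) (ν' : Measure (ZSeq Bool)) : Prop :=
  ∃ νseq : ℕ → Measure (ZSeq Bool),
    (∀ n, CylTendsto (fun l => ν[|blockEvt n l b]) (νseq n)) ∧ CylTendsto νseq ν'

/-- Stochastic domination: `ν ≤ μ` iff `ν B ≤ μ B` for every increasing measurable event `B`. -/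
def StochDom {A : Type*} [MeasurableSpace A] [Preorder A]
    (ν μ : Measure (ZSeq A)) : Prop :=
  ∀ B : Set (ZSeq A), MeasurableSet B → (∀ ⦃x y : ZSeq A⦄, x ≤ y → x ∈ B → y ∈ B) → ν B ≤ μ B

/-- `π` is the i.i.d. product measure with `π(η_i = +1) = ρ` for each coordinate. -/
def IsBernoulliProd (ρ : ℝ) (π : Measure (ZSeq Bool)) : Prop :=
  IsProbabilityMeasure π ∧ ∀ (s : Finset ℤ) (f : ℤ → Bool),
    π {η | ∀ i ∈ s, η i = f i} = ∏ i ∈ s, ENNReal.ofReal (if f i then ρ else 1 - ρ)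

/-- Splicing of pasts: coordinates `−k,…,−1` (indices `< k`) from `ω`, the rest from `σ`. -/
def splice {A : Type*} (σ ω : Past A) (k : ℕ) : Past A := fun j => if j < k then ω j else σ j

/-- `ν'` is an extreme point of the convex set of g-measures consistent with `P`. -/
def ExtremeGMeasure (ν' : Measure (ZSeq Bool)) (P : Bool → Past Bool → ℝ) : Prop :=
  IsGMeasure ν' P ∧
  ∀ ν₁ ν₂ : Measure (ZSeq Bool), IsGMeasure ν₁ P → IsGMeasure ν₂ P →
    ∀ t : ℝ, t ∈ Set.Ioo (0 : ℝ) 1 →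
      ν' = ENNReal.ofReal t • ν₁ + ENNReal.ofReal (1 - t) • ν₂ → ν₁ = ν' ∧ ν₂ = ν'

/-- The event that the spins on the line are `−1` on `{−m,…,−n} × {0}`. -/
def lineMinusEvt (n m : ℕ) : Set Cfg2 :=
  {η | ∀ i : ℤ, -(m : ℤ) ≤ i → i ≤ -(n : ℤ) → η (i, 0) = false}

/-- Nearest-neighbour adjacency in `ℤ²` (`‖x−y‖₁ = 1`). -/
def adj2 (x y : ℤ × ℤ) : Prop := (x.1 - y.1).natAbs + (x.2 - y.2).natAbs = 1

/-- The event `A_n`: there is an infinite nearest-neighbour path of `+1` spins starting at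
`(n,0)` entirely contained in the half-plane `{x ≤ n}`. -/
def plusPathEvt (n : ℕ) : Set Cfg2 :=
  {η | ∃ γ : ℕ → ℤ × ℤ, γ 0 = ((n : ℤ), 0) ∧ (∀ j, adj2 (γ j) (γ (j + 1))) ∧
    Function.Injective γ ∧ (∀ j, (γ j).1 ≤ (n : ℤ)) ∧ ∀ j, η (γ j) = true}

/-- The block map for the decimation `ν_{l,k}`: the `j`-th letter consists of the spins on
`[j(k+l), j(k+l)+l−1]`. -/
def blockMap (l k : ℕ) (η : ZSeq Bool) : ZSeq (Fin l → Bool) :=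
  fun j r => η (j * ((k : ℤ) + l) + r)

end

namespace IsingLine

open Finset

noncomputable section

/-- The endpoint of an oriented edge, `true` being horizontal and `false` vertical. -/
def tip (e : (ℤ × ℤ) × Bool) : ℤ × ℤ := if e.2 then (e.1.1 + 1, e.1.2) else (e.1.1, e.1.2 + 1)

/-- The edges with at least one endpoint in `Λ`. -/
def edges (Λ : Finset (ℤ × ℤ)) : Finset ((ℤ × ℤ) × Bool) :=
  (Λ ×ˢ univ) ∪ (Λ.image (fun x => ((x.1 - 1, x.2), true)) ∪
    Λ.image (fun x => ((x.1, x.2 - 1), false)))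

lemma mem_edges {Λ : Finset (ℤ × ℤ)} {e : (ℤ × ℤ) × Bool} :
    e ∈ edges Λ ↔ e.1 ∈ Λ ∨ tip e ∈ Λ := by
  obtain ⟨⟨x, y⟩, b⟩ := e
  cases b <;> simp only [edges, tip, mem_union, mem_product, mem_univ, and_true, mem_image,
    Prod.mk.injEq, Prod.exists, Bool.false_eq_true, Bool.true_eq_false, and_false, exists_false,
    false_or, or_false, if_true, if_false] <;> refine or_congr Iff.rfl ⟨?_, fun h => ?_⟩
  · rintro ⟨a, b, h, rfl, rfl⟩
    simpa using h
  · exact ⟨x, y + 1, h, rfl, by simp⟩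
  · rintro ⟨a, b, h, rfl, rfl⟩
    simpa using h
  · exact ⟨x + 1, y, h, by simp, rfl⟩

/-- The contribution of an edge to the energy. -/
def bond (ω : Cfg2) (e : (ℤ × ℤ) × Bool) : ℝ := sval (ω e.1) * sval (ω (tip e))

/-- The energy of the edges touching `Λ`. -/
def en (Λ : Finset (ℤ × ℤ)) (ω : Cfg2) : ℝ := ∑ e ∈ edges Λ, bond ω e

/-- The Boltzmann weight of the edges touching `Λ`. -/
def wt (β : ℝ) (Λ : Finset (ℤ × ℤ)) (ω : Cfg2) : ℝ := Real.exp (β * en Λ ω)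

/-- The configurations that agree with `σ` off `Λ`. -/
def cfgs (Λ : Finset (ℤ × ℤ)) (σ : Cfg2) : Finset Cfg2 := by
  classical exact univ.image (fill Λ σ)

lemma mem_cfgs {Λ : Finset (ℤ × ℤ)} {σ ω : Cfg2} :
    ω ∈ cfgs Λ σ ↔ ∀ x, x ∉ Λ → ω x = σ x := by
  classical
  simp only [cfgs, mem_image, mem_univ, true_and]
  constructor
  · rintro ⟨τ, rfl⟩ x hx
    simp [fill, hx]
  · intro h
    refine ⟨fun x => ω x, funext fun x => ?_⟩
    by_cases hx : x ∈ Λ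
    · simp [fill, hx]
    · simp [fill, hx, h x hx]

lemma self_mem_cfgs (Λ : Finset (ℤ × ℤ)) (σ : Cfg2) : σ ∈ cfgs Λ σ := mem_cfgs.2 fun _ _ => rfl

lemma fill_injective (Λ : Finset (ℤ × ℤ)) (σ : Cfg2) : Function.Injective (fill Λ σ) := by
  intro τ τ' h
  funext x
  have := congrFun h x
  simpa [fill] using this

lemma sum_cfgs {M : Type*} [AddCommMonoid M] (Λ : Finset (ℤ × ℤ)) (σ : Cfg2) (f : Cfg2 → M) :
    ∑ ω ∈ cfgs Λ σ, f ω = ∑ τ : ↥Λ → Bool, f (fill Λ σ τ) := by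
  classical
  rw [cfgs, sum_image fun _ _ _ _ h => fill_injective Λ σ h]

lemma cfgs_congr {Λ : Finset (ℤ × ℤ)} {σ σ' : Cfg2} (h : ∀ x, x ∉ Λ → σ x = σ' x) :
    cfgs Λ σ = cfgs Λ σ' := by
  ext ω
  simp only [mem_cfgs]
  exact forall₂_congr fun x hx => by rw [h x hx]

/-- Finite-volume expectation with boundary condition `σ` and zero field. -/
def ev (β : ℝ) (Λ : Finset (ℤ × ℤ)) (σ : Cfg2) (f : Cfg2 → ℝ) : ℝ :=
  (∑ ω ∈ cfgs Λ σ, wt β Λ ω * f ω) / ∑ ω ∈ cfgs Λ σ, wt β Λ ω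

variable {β : ℝ} {Λ Δ : Finset (ℤ × ℤ)} {σ σ' : Cfg2} {f g : Cfg2 → ℝ}

lemma wt_pos (β : ℝ) (Λ : Finset (ℤ × ℤ)) (ω : Cfg2) : 0 < wt β Λ ω := Real.exp_pos _

lemma partition_pos (β : ℝ) (Λ : Finset (ℤ × ℤ)) (σ : Cfg2) : 0 < ∑ ω ∈ cfgs Λ σ, wt β Λ ω :=
  sum_pos (fun _ _ => wt_pos _ _ _) ⟨σ, self_mem_cfgs Λ σ⟩

lemma ev_congr_bc (h : ∀ x, x ∉ Λ → σ x = σ' x) : ev β Λ σ f = ev β Λ σ' f := by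
  rw [ev, ev, cfgs_congr h]

lemma ev_congr (h : ∀ ω ∈ cfgs Λ σ, f ω = g ω) : ev β Λ σ f = ev β Λ σ g := by
  rw [ev, ev, sum_congr rfl fun ω hω => by rw [h ω hω]]

lemma ev_mono (h : ∀ ω ∈ cfgs Λ σ, f ω ≤ g ω) : ev β Λ σ f ≤ ev β Λ σ g := by
  refine div_le_div_of_nonneg_right (sum_le_sum fun ω hω => ?_) (partition_pos β Λ σ).le
  exact mul_le_mul_of_nonneg_left (h ω hω) (wt_pos _ _ _).le

lemma ev_const (c : ℝ) : ev β Λ σ (fun _ => c) = c := by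
  rw [ev, ← sum_mul, mul_div_cancel_left₀ _ (partition_pos β Λ σ).ne']

lemma ev_add : ev β Λ σ (fun ω => f ω + g ω) = ev β Λ σ f + ev β Λ σ g := by
  simp only [ev, mul_add, sum_add_distrib, add_div]

lemma ev_const_mul (c : ℝ) : ev β Λ σ (fun ω => c * f ω) = c * ev β Λ σ f := by
  simp only [ev, ← mul_div_assoc, mul_sum]
  congr 1
  exact sum_congr rfl fun _ _ => by ring

lemma ev_sub : ev β Λ σ (fun ω => f ω - g ω) = ev β Λ σ f - ev β Λ σ g := by
  simp only [ev, mul_sub, sum_sub_distrib, sub_div]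

lemma ev_sum {ι : Type*} (s : Finset ι) (F : ι → Cfg2 → ℝ) :
    ev β Λ σ (fun ω => ∑ i ∈ s, F i ω) = ∑ i ∈ s, ev β Λ σ (F i) := by
  simp only [ev, ← sum_div, mul_sum]
  rw [sum_comm]

lemma ev_nonneg (h : ∀ ω ∈ cfgs Λ σ, 0 ≤ f ω) : 0 ≤ ev β Λ σ f := by
  simpa [ev_const] using ev_mono (β := β) (f := fun _ => 0) h

lemma ev_pos (h : ∀ ω ∈ cfgs Λ σ, 0 ≤ f ω) {ω : Cfg2} (hω : ω ∈ cfgs Λ σ) (hf : 0 < f ω) :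
    0 < ev β Λ σ f := by
  refine div_pos (sum_pos' (fun ω hω => mul_nonneg (wt_pos _ _ _).le (h ω hω))
    ⟨ω, hω, mul_pos (wt_pos _ _ _) hf⟩) (partition_pos β Λ σ)

lemma edges_mono (h : Δ ⊆ Λ) : edges Δ ⊆ edges Λ := fun e he => by
  rw [mem_edges] at *
  exact he.imp (@h _) (@h _)

lemma en_sub (h : Δ ⊆ Λ) {ω ω' : Cfg2} (hω : ∀ x, x ∉ Δ → ω x = ω' x) :
    en Λ ω - en Λ ω' = en Δ ω - en Δ ω' := by
  simp only [en, ← sum_sub_distrib]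
  refine (sum_subset (edges_mono h) fun e _ he => ?_).symm
  rw [mem_edges, not_or] at he
  simp [bond, hω _ he.1, hω _ he.2]

lemma wt_mul_wt (h : Δ ⊆ Λ) {ω ω' : Cfg2} (hω : ∀ x, x ∉ Δ → ω x = ω' x) :
    wt β Λ ω * wt β Δ ω' = wt β Λ ω' * wt β Δ ω := by
  simp only [wt, ← Real.exp_add]
  congr 1
  linear_combination β * en_sub h hω

lemma ev_tower (h : Δ ⊆ Λ) (σ : Cfg2) (f : Cfg2 → ℝ) :
    ev β Λ σ (fun ω => ev β Δ ω f) = ev β Λ σ f := by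
  have key : ∑ ω ∈ cfgs Λ σ, wt β Λ ω * ev β Δ ω f = ∑ ω ∈ cfgs Λ σ, wt β Λ ω * f ω := by
    have h1 : ∀ ω ∈ cfgs Λ σ, wt β Λ ω * ev β Δ ω f =
        ∑ ω' ∈ cfgs Δ ω, wt β Λ ω' * f ω' * wt β Δ ω / ∑ η ∈ cfgs Δ ω', wt β Δ η := by
      intro ω _
      rw [ev, ← mul_div_assoc, mul_sum, sum_div]
      refine sum_congr rfl fun ω' hω' => ?_
      rw [mem_cfgs] at hω'
      rw [cfgs_congr hω', ← mul_assoc, wt_mul_wt h fun x hx => (hω' x hx).symm]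
      ring
    rw [sum_congr rfl h1, sum_comm' (t' := cfgs Λ σ) (s' := fun ω' => cfgs Δ ω')]
    · refine sum_congr rfl fun ω' _ => ?_
      have := (partition_pos β Δ ω').ne'
      rw [← sum_div, ← mul_sum, mul_div_assoc, div_self this, mul_one]
    · intro ω ω'
      simp only [mem_cfgs]
      constructor
      · rintro ⟨h1, h2⟩
        exact ⟨fun x hx => (h2 x hx).symm,
          fun x hx => (h2 x fun h' => hx (h h')).trans (h1 x hx)⟩
      · rintro ⟨h1, h2⟩
        exact ⟨fun x hx => (h1 x fun h' => hx (h h')).trans (h2 x hx),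
          fun x hx => (h1 x hx).symm⟩
  rw [ev, key, ← ev]

lemma sval_supermodular (a b c d : Bool) :
    sval a * sval b + sval c * sval d ≤ sval (a ⊓ c) * sval (b ⊓ d) + sval (a ⊔ c) * sval (b ⊔ d) := by
  cases a <;> cases b <;> cases c <;> cases d <;> norm_num [sval]

lemma en_supermodular (Λ : Finset (ℤ × ℤ)) (ω ω' : Cfg2) :
    en Λ ω + en Λ ω' ≤ en Λ (ω ⊓ ω') + en Λ (ω ⊔ ω') := by
  simp only [en, ← sum_add_distrib]
  exact sum_le_sum fun e _ => sval_supermodular _ _ _ _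

lemma ev_mono_bc (hβ : 0 ≤ β) (h : σ ≤ σ') (hf : Monotone f) : ev β Λ σ f ≤ ev β Λ σ' f := by
  classical
  have hinf : ∀ a b, fill Λ σ a ⊓ fill Λ σ' b = fill Λ σ (a ⊓ b) := by
    intro a b
    funext x
    by_cases hx : x ∈ Λ
    · simp [fill, hx]
    · have : σ x ⊓ σ' x = σ x := inf_eq_left.2 (h x)
      simpa only [fill, hx, Pi.inf_apply, dif_neg, not_false_eq_true] using this
  have hsup : ∀ a b, fill Λ σ a ⊔ fill Λ σ' b = fill Λ σ' (a ⊔ b) := by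
    intro a b
    funext x
    by_cases hx : x ∈ Λ
    · simp [fill, hx]
    · have : σ x ⊔ σ' x = σ' x := sup_eq_right.2 (h x)
      simpa only [fill, hx, Pi.sup_apply, dif_neg, not_false_eq_true] using this
  have hbd : ∃ c, ∀ ω ∈ cfgs Λ σ ∪ cfgs Λ σ', c ≤ f ω := by
    obtain ⟨c, hc⟩ := ((cfgs Λ σ ∪ cfgs Λ σ').image f).bddBelow
    exact ⟨c, fun ω hω => hc (by simpa using ⟨ω, by simpa using hω, rfl⟩)⟩
  obtain ⟨c, hc⟩ := hbd
  have hfm : Monotone (fill Λ σ) := fun a b hab x => by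
    by_cases hx : x ∈ Λ
    · simpa [fill, hx] using hab ⟨x, hx⟩
    · simp [fill, hx]
  have hle : ∀ τ, fill Λ σ τ ≤ fill Λ σ' τ := fun τ x => by
    by_cases hx : x ∈ Λ
    · simp [fill, hx]
    · simpa [fill, hx] using h x
  set m : (↥Λ → Bool) → ℝ := fun τ => f (fill Λ σ τ) - c
  set p : (↥Λ → Bool) → ℝ := fun τ => wt β Λ (fill Λ σ τ) / ∑ ω ∈ cfgs Λ σ, wt β Λ ω
  set p' : (↥Λ → Bool) → ℝ := fun τ => wt β Λ (fill Λ σ' τ) / ∑ ω ∈ cfgs Λ σ', wt β Λ ω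
  have hp : ∀ τ, 0 ≤ p τ := fun τ => div_nonneg (wt_pos _ _ _).le (partition_pos _ _ _).le
  have hp' : ∀ τ, 0 ≤ p' τ := fun τ => div_nonneg (wt_pos _ _ _).le (partition_pos _ _ _).le
  have hs : ∑ τ, p τ = 1 := by
    rw [← sum_div, ← sum_cfgs Λ σ (wt β Λ), div_self (partition_pos _ _ _).ne']
  have hs' : ∑ τ, p' τ = 1 := by
    rw [← sum_div, ← sum_cfgs Λ σ' (wt β Λ), div_self (partition_pos _ _ _).ne']
  have hol := holley (μ := m) (f := p) (g := p')
    (fun τ => sub_nonneg.2 (hc _ (mem_union_left _ (mem_image_of_mem _ (mem_univ τ))))) hp hp'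
    (fun a b hab => sub_le_sub_right (hf (hfm hab)) c) (hs.trans hs'.symm) (fun a b => by
      simp only [p, p', div_mul_div_comm]
      refine div_le_div_of_nonneg_right ?_
        (mul_pos (partition_pos _ _ _) (partition_pos _ _ _)).le
      rw [← hinf, ← hsup, wt, wt, wt, wt, ← Real.exp_add, ← Real.exp_add, ← mul_add, ← mul_add]
      exact Real.exp_le_exp.2 (mul_le_mul_of_nonneg_left (en_supermodular _ _ _) hβ))
  have e1 : ev β Λ σ f = ∑ τ, f (fill Λ σ τ) * p τ := by
    rw [ev, sum_cfgs Λ σ (fun ω => wt β Λ ω * f ω), sum_div]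
    exact sum_congr rfl fun τ _ => by simp only [p]; ring
  have e2 : ev β Λ σ' f = ∑ τ, f (fill Λ σ' τ) * p' τ := by
    rw [ev, sum_cfgs Λ σ' (fun ω => wt β Λ ω * f ω), sum_div]
    exact sum_congr rfl fun τ _ => by simp only [p']; ring
  simp only [m, sub_mul, sum_sub_distrib, ← mul_sum, hs, hs'] at hol
  rw [e1, e2]
  refine (sub_le_sub_iff_right _).1 hol |>.trans (sum_le_sum fun τ _ => ?_)
  exact mul_le_mul_of_nonneg_right (hf (hle τ)) (hp' τ)

/-- The constant plus configuration. -/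
abbrev plus : Cfg2 := fun _ => true

lemma le_plus (ω : Cfg2) : ω ≤ plus := fun _ => Bool.le_true _

lemma ev_plus_antitone (hβ : 0 ≤ β) (h : Δ ⊆ Λ) (hf : Monotone f) :
    ev β Λ plus f ≤ ev β Δ plus f := by
  rw [← ev_tower h plus f]
  refine (ev_mono fun ω _ => ev_mono_bc hβ (le_plus ω) hf).trans (ev_const _).le

open Classical in
/-- The indicator of the event that the configuration agrees with `a` on `T`. -/
def cyl (T : Finset (ℤ × ℤ)) (a ω : Cfg2) : ℝ := if ∀ x ∈ T, ω x = a x then 1 else 0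

lemma cyl_nonneg (T : Finset (ℤ × ℤ)) (a ω : Cfg2) : 0 ≤ cyl T a ω := by
  rw [cyl]; split_ifs <;> norm_num

lemma cyl_le_one (T : Finset (ℤ × ℤ)) (a ω : Cfg2) : cyl T a ω ≤ 1 := by
  rw [cyl]; split_ifs <;> norm_num

lemma cyl_minus_anti (T : Finset (ℤ × ℤ)) : Antitone (cyl T fun _ => false) := by
  intro ω ω' h
  simp only [cyl]
  split_ifs with h1 h2 <;> try norm_num
  exact h2 fun x hx => le_bot_iff.1 ((h x).trans (h1 x hx).le)

lemma ev_anti (hβ : 0 ≤ β) (h : σ ≤ σ') (hf : Antitone f) : ev β Λ σ' f ≤ ev β Λ σ f := by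
  have := ev_mono_bc (Λ := Λ) hβ h (f := fun ω => -1 * f ω) (fun a b hab => by
    simpa using hf hab)
  rw [ev_const_mul, ev_const_mul] at this
  linarith

lemma ev_plus_mono (hβ : 0 ≤ β) (h : Δ ⊆ Λ) (hf : Antitone f) :
    ev β Δ plus f ≤ ev β Λ plus f := by
  have := ev_plus_antitone hβ h (f := fun ω => -1 * f ω) (fun a b hab => by
    simpa using hf hab)
  rw [ev_const_mul, ev_const_mul] at this
  linarith

/-- Conditioning on the spins in `T`. -/
lemma ev_cyl_mul (T : Finset (ℤ × ℤ)) (a σ : Cfg2) (f : Cfg2 → ℝ) :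
    ev β Λ σ (fun ω => cyl T a ω * f ω) =
      ev β Λ σ (cyl T a) * ev β (Λ \ T) (T.piecewise a σ) f := by
  rw [← ev_tower (sdiff_subset (s := Λ) (t := T)), mul_comm, ← ev_const_mul]
  refine ev_congr fun ω hω => ?_
  rw [mem_cfgs] at hω
  have h1 : ev β (Λ \ T) ω (fun ω => cyl T a ω * f ω) = cyl T a ω * ev β (Λ \ T) ω f := by
    rw [← ev_const_mul]
    refine ev_congr fun ω' hω' => ?_
    rw [mem_cfgs] at hω'
    congr 1
    simp only [cyl]
    refine if_congr (forall₂_congr fun x hx => ?_) rfl rfl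
    rw [hω' x (by simp [hx])]
  rw [h1, mul_comm]
  by_cases h : ∀ x ∈ T, ω x = a x
  · congr 1
    refine ev_congr_bc fun x hx => ?_
    by_cases hxT : x ∈ T
    · simp [hxT, h x hxT]
    · have hx : x ∉ Λ := fun h => hx (Finset.mem_sdiff.2 ⟨h, hxT⟩)
      simp [hxT, hω x hx]
  · have : cyl T a ω = 0 := if_neg h
    simp [this]

/-- Positive correlation of decreasing functions with the event that a block is minus. -/
lemma ev_minus_mul_ge (hβ : 0 ≤ β) (T : Finset (ℤ × ℤ)) (hf : Antitone f) :
    ev β Λ σ (cyl T fun _ => false) * ev β Λ σ f ≤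
      ev β Λ σ (fun ω => cyl T (fun _ => false) ω * f ω) := by
  classical
  rw [ev_cyl_mul]
  refine mul_le_mul_of_nonneg_left ?_ (ev_nonneg fun _ _ => cyl_nonneg _ _ _)
  rw [← ev_tower (sdiff_subset (s := Λ) (t := T)) σ f]
  calc _ ≤ ev β Λ σ (fun _ => ev β (Λ \ T) (T.piecewise (fun _ => false) σ) f) :=
        ev_mono fun ω hω => ?_
    _ = _ := ev_const _
  have h2 : ev β (Λ \ T) ω f = ev β (Λ \ T) (T.piecewise ω σ) f := by
    refine ev_congr_bc fun x hx => ?_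
    by_cases hxT : x ∈ T
    · simp [hxT]
    · have hx : x ∉ Λ := fun h => hx (Finset.mem_sdiff.2 ⟨h, hxT⟩)
      simp [hxT, mem_cfgs.1 hω x hx]
  rw [h2]
  refine ev_anti hβ (fun x => ?_) hf
  by_cases hxT : x ∈ T <;> simp [hxT]

end

end IsingLine

namespace IsingLine

open Finset

noncomputable section

variable {β : ℝ} {Λ Δ : Finset (ℤ × ℤ)} {σ σ' : Cfg2} {f g : Cfg2 → ℝ}

lemma sum_nbrs (x : ℤ × ℤ) (F : ℤ × ℤ → ℝ) : ∑ y ∈ nbrs x, F y =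
    F (x.1 + 1, x.2) + F (x.1 - 1, x.2) + F (x.1, x.2 + 1) + F (x.1, x.2 - 1) := by
  have h1 : (x.1 + 1 : ℤ) ≠ x.1 - 1 := by omega
  have h2 : (x.2 + 1 : ℤ) ≠ x.2 - 1 := by omega
  rw [nbrs, sum_insert, sum_insert, sum_insert, sum_singleton]
  · ring
  all_goals simp [h1, h2]

lemma sum_edges (Λ : Finset (ℤ × ℤ)) (F : (ℤ × ℤ) × Bool → ℝ) : ∑ e ∈ edges Λ, F e =
    ∑ x ∈ Λ, (F (x, true) + F (x, false)
      + (if (x.1 - 1, x.2) ∈ Λ then 0 else F ((x.1 - 1, x.2), true))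
      + (if (x.1, x.2 - 1) ∈ Λ then 0 else F ((x.1, x.2 - 1), false))) := by
  have hE : edges Λ = (Λ ×ˢ univ) ∪
      ((Λ.filter fun x => (x.1 - 1, x.2) ∉ Λ).image (fun x => ((x.1 - 1, x.2), true)) ∪
       (Λ.filter fun x => (x.1, x.2 - 1) ∉ Λ).image (fun x => ((x.1, x.2 - 1), false))) := by
    ext ⟨y, b⟩
    simp only [edges, mem_union, mem_product, mem_univ, and_true, mem_image, mem_filter]
    by_cases hy : y ∈ Λ
    · simp [hy]
    · simp only [hy, false_or]
      refine or_congr (exists_congr fun x => ⟨?_, ?_⟩) (exists_congr fun x => ⟨?_, ?_⟩)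
      · rintro ⟨h, h'⟩
        refine ⟨⟨h, ?_⟩, h'⟩
        rw [Prod.mk.injEq] at h'
        rwa [h'.1]
      · rintro ⟨h, h'⟩
        exact ⟨h.1, h'⟩
      · rintro ⟨h, h'⟩
        refine ⟨⟨h, ?_⟩, h'⟩
        rw [Prod.mk.injEq] at h'
        rwa [h'.1]
      · rintro ⟨h, h'⟩
        exact ⟨h.1, h'⟩
  rw [hE, sum_union, sum_union, sum_product, sum_image, sum_image, sum_filter, sum_filter,
    ← sum_add_distrib, ← sum_add_distrib]
  · refine sum_congr rfl fun x _ => ?_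
    rw [Fintype.sum_bool, ite_not, ite_not]
    ring
  · rintro ⟨a, b⟩ _ ⟨c, d⟩ _ h
    simpa using h
  · rintro ⟨a, b⟩ _ ⟨c, d⟩ _ h
    simpa using h
  · rw [disjoint_left]
    rintro ⟨y, b⟩ h1 h2
    simp only [mem_image, Prod.mk.injEq] at h1 h2
    obtain ⟨_, _, _, rfl⟩ := h1
    obtain ⟨_, _, _, h⟩ := h2
    simp at h
  · rw [disjoint_left]
    rintro ⟨y, b⟩ h1 h2
    simp only [mem_product, mem_univ, and_true, mem_union, mem_image, mem_filter,
      Prod.mk.injEq] at h1 h2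
    obtain ⟨_, ⟨_, h⟩, rfl, _⟩ | ⟨_, ⟨_, h⟩, rfl, _⟩ := h2 <;> exact h h1

lemma sum_shift (Λ : Finset (ℤ × ℤ)) (a : ℤ × ℤ) (F : ℤ × ℤ → ℤ × ℤ → ℝ) :
    ∑ x ∈ Λ, (if x + a ∈ Λ then F x (x + a) else 0) =
      ∑ x ∈ Λ, (if x - a ∈ Λ then F (x - a) x else 0) := by
  rw [← sum_filter, ← sum_filter]
  refine sum_bij' (fun x _ => x + a) (fun x _ => x - a) ?_ ?_ ?_ ?_ ?_ <;>
    simp +contextual [mem_filter]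

/-- The edgewise energy agrees with the sum over sites in the definition of the Ising weight. -/
lemma en_eq (Λ : Finset (ℤ × ℤ)) (ω : Cfg2) : en Λ ω =
    (∑ x ∈ Λ, ∑ y ∈ Λ.filter (fun y => y ∈ nbrs x), sval (ω x) * sval (ω y)) / 2
      + ∑ x ∈ Λ, ∑ y ∈ (nbrs x).filter (fun y => y ∉ Λ), sval (ω x) * sval (ω y) := by
  have h1 : ∀ x, Λ.filter (fun y => y ∈ nbrs x) = (nbrs x).filter (fun y => y ∈ Λ) := fun x => by
    ext y; simp [and_comm]
  simp only [h1]
  rw [sum_div, ← sum_add_distrib, en, sum_edges]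
  have h2 := sum_shift Λ (1, 0) (fun x y => sval (ω x) * sval (ω y))
  have h3 := sum_shift Λ (0, 1) (fun x y => sval (ω x) * sval (ω y))
  rw [← sub_eq_zero] at h2 h3 ⊢
  rw [← sum_sub_distrib] at h2 h3 ⊢
  have h4 : ∀ A B C : ℝ, A = 0 → B = 0 → C = 1 / 2 * (A + B) → C = 0 := by
    rintro A B C rfl rfl h; simpa using h
  refine h4 _ _ _ h2 h3 ?_
  rw [← sum_add_distrib, mul_sum]
  refine sum_congr rfl fun x _ => ?_
  rw [sum_filter, sum_filter, sum_nbrs, sum_nbrs]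
  obtain ⟨x, y⟩ := x
  simp only [bond, tip, Prod.mk_add_mk, Prod.mk_sub_mk, add_zero, sub_zero, if_true,
    Bool.false_eq_true, if_false, sub_add_cancel, ite_not]
  split_ifs <;> ring

lemma isingWeight_eq {ω : Cfg2} (hω : ω ∈ cfgs Λ σ) : isingWeight β 0 Λ σ ω = wt β Λ ω := by
  rw [isingWeight, wt, en_eq, zero_mul, sub_zero]
  congr 3
  refine sum_congr rfl fun x _ => sum_congr rfl fun y hy => ?_
  rw [mem_cfgs.1 hω y (mem_filter.1 hy).2]

lemma isingFV_apply {S : Set Cfg2} (hS : MeasurableSet S) :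
    isingFV β 0 Λ σ S = ENNReal.ofReal (ev β Λ σ (S.indicator 1)) := by
  have hm : ∀ τ, isingWeight β 0 Λ σ (fill Λ σ τ) = wt β Λ (fill Λ σ τ) := fun τ =>
    isingWeight_eq (mem_cfgs.2 fun x hx => by simp [fill, hx])
  simp only [isingFV, hm]
  rw [ev, sum_cfgs Λ σ (wt β Λ), sum_cfgs Λ σ (fun ω => wt β Λ ω * S.indicator 1 ω),
    Measure.smul_apply, Measure.finsetSum_apply, smul_eq_mul,
    ← ENNReal.ofReal_sum_of_nonneg (fun _ _ => (wt_pos _ _ _).le)]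
  have hp : 0 < ∑ τ, wt β Λ (fill Λ σ τ) := by
    rw [← sum_cfgs Λ σ (wt β Λ)]; exact partition_pos _ _ _
  rw [ENNReal.ofReal_div_of_pos hp, div_eq_mul_inv, mul_comm,
    ENNReal.ofReal_sum_of_nonneg (f := fun τ => wt β Λ (fill Λ σ τ) * S.indicator 1 (fill Λ σ τ))]
  · congr 1
    refine sum_congr rfl fun τ _ => ?_
    rw [Measure.smul_apply, Measure.dirac_apply' _ hS, smul_eq_mul,
      ENNReal.ofReal_mul (wt_pos _ _ _).le]
    congr 1
    by_cases h : fill Λ σ τ ∈ S <;> simp [h]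
  · intro τ _
    refine mul_nonneg (wt_pos _ _ _).le (Set.indicator_nonneg (fun _ _ => zero_le_one) _)

/-- Translation of configurations. -/
def sh (a : ℤ × ℤ) : Cfg2 ≃ Cfg2 where
  toFun ω x := ω (x + a)
  invFun ω x := ω (x - a)
  left_inv ω := by funext x; simp
  right_inv ω := by funext x; simp

lemma wt_sh (a : ℤ × ℤ) (ω : Cfg2) : wt β (Λ.image (· - a)) (sh a ω) = wt β Λ ω := by
  rw [wt, wt, en, en]
  congr 2
  have ht : ∀ e : (ℤ × ℤ) × Bool, tip (e.1 - a, e.2) = tip e - a := by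
    rintro ⟨⟨x, y⟩, b⟩
    obtain ⟨c, d⟩ := a
    cases b <;> simp [tip] <;> ring
  have hm : ∀ x, x ∈ Λ.image (· - a) ↔ x + a ∈ Λ := fun x => by
    simp only [mem_image]
    exact ⟨by rintro ⟨y, hy, rfl⟩; simpa using hy, fun h => ⟨_, h, by simp⟩⟩
  symm
  refine sum_bij' (fun e _ => (e.1 - a, e.2)) (fun e _ => (e.1 + a, e.2)) ?_ ?_ ?_ ?_ ?_
  · intro e he
    rw [mem_edges] at *
    rw [ht, hm, hm]
    simpa using he
  · intro e he
    have := ht (e.1 + a, e.2)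
    simp only [add_sub_cancel_right] at this
    rw [mem_edges] at *
    rw [this, hm, hm] at he
    simpa using he
  · intro e _; simp
  · intro e _; simp
  · intro e _
    simp [bond, ht, sh]

lemma ev_sh (a : ℤ × ℤ) :
    ev β (Λ.image (· - a)) (sh a σ) f = ev β Λ σ (fun ω => f (sh a ω)) := by
  have h : cfgs (Λ.image (· - a)) (sh a σ) = (cfgs Λ σ).map (sh a).toEmbedding := by
    ext ω
    rw [mem_map_equiv, mem_cfgs, mem_cfgs]
    simp only [mem_image, sh, Equiv.coe_fn_mk, Equiv.coe_fn_symm_mk]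
    constructor
    · intro h x hx
      have := h (x - a) (by rintro ⟨y, hy, h⟩; exact hx (by rwa [sub_left_inj.1 h] at hy))
      simpa using this
    · intro h x hx
      have := h (x + a) (fun h' => hx ⟨_, h', by simp⟩)
      simpa using this
  rw [ev, ev, h, sum_map, sum_map]
  simp only [Equiv.coe_toEmbedding, wt_sh]

lemma ev_sh_plus (a : ℤ × ℤ) :
    ev β (Λ.image (· - a)) plus f = ev β Λ plus (fun ω => f (sh a ω)) := ev_sh (σ := plus) a

/-- Global spin flip. -/
def flip : Cfg2 ≃ Cfg2 where
  toFun ω x := !ω x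
  invFun ω x := !ω x
  left_inv ω := by funext x; simp
  right_inv ω := by funext x; simp

lemma sval_not (b : Bool) : sval (!b) = -sval b := by cases b <;> simp [sval]

lemma ev_flip : ev β Λ (flip σ) f = ev β Λ σ (fun ω => f (flip ω)) := by
  have h : cfgs Λ (flip σ) = (cfgs Λ σ).map flip.toEmbedding := by
    ext ω
    rw [mem_map_equiv, mem_cfgs, mem_cfgs]
    simp only [flip, Equiv.coe_fn_mk, Equiv.coe_fn_symm_mk]
    exact forall₂_congr fun x _ => by cases ω x <;> cases σ x <;> simp
  have hw : ∀ ω, wt β Λ (flip ω) = wt β Λ ω := fun ω => by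
    simp [wt, en, bond, flip, sval_not]
  rw [ev, ev, h, sum_map, sum_map]
  simp only [Equiv.coe_toEmbedding, hw]

/-- The sum of the spins along the outer boundary of `Q`. -/
def bdry (Q : Finset (ℤ × ℤ)) (ω : Cfg2) : ℝ :=
  ∑ x ∈ Q, ∑ y ∈ (nbrs x).filter (fun y => y ∉ Q), sval (ω y)

lemma sval_mono : Monotone sval := by
  intro a b h
  cases a <;> cases b <;> first | exact absurd h (by decide) | norm_num [sval]

lemma abs_sval (b : Bool) : |sval b| = 1 := by cases b <;> simp [sval]

/-- Raising the boundary condition raises the energy by at most the change of the boundary sum. -/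
lemma en_fill_sub_le (Q : Finset (ℤ × ℤ)) {ω ω' : Cfg2} (h : ω ≤ ω') (τ : ↥Q → Bool) :
    en Q (fill Q ω' τ) - en Q (fill Q ω τ) ≤ bdry Q ω' - bdry Q ω ∧
      -(bdry Q ω' - bdry Q ω) ≤ en Q (fill Q ω' τ) - en Q (fill Q ω τ) := by
  have hin : ∀ x ∈ Q, ∀ η, fill Q η τ x = fill Q ω τ x := fun x hx η => by simp [fill, hx]
  have hout : ∀ x ∉ Q, ∀ η, fill Q η τ x = η x := fun x hx η => by simp [fill, hx]
  have key : en Q (fill Q ω' τ) - en Q (fill Q ω τ) =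
      ∑ x ∈ Q, ∑ y ∈ (nbrs x).filter (fun y => y ∉ Q),
        sval (fill Q ω τ x) * (sval (ω' y) - sval (ω y)) := by
    have e1 : (∑ x ∈ Q, ∑ y ∈ Q.filter (fun y => y ∈ nbrs x),
        sval (fill Q ω' τ x) * sval (fill Q ω' τ y)) =
        ∑ x ∈ Q, ∑ y ∈ Q.filter (fun y => y ∈ nbrs x),
        sval (fill Q ω τ x) * sval (fill Q ω τ y) :=
      sum_congr rfl fun x hx => sum_congr rfl fun y hy => by
        rw [hin x hx ω', hin y (mem_filter.1 hy).1 ω']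
    rw [en_eq, en_eq, e1, add_sub_add_left_eq_sub, ← sum_sub_distrib]
    refine sum_congr rfl fun x hx => ?_
    rw [← sum_sub_distrib]
    refine sum_congr rfl fun y hy => ?_
    rw [hin x hx ω', hout y (mem_filter.1 hy).2, hout y (mem_filter.1 hy).2]
    ring
  have hb : bdry Q ω' - bdry Q ω = ∑ x ∈ Q, ∑ y ∈ (nbrs x).filter (fun y => y ∉ Q),
      (sval (ω' y) - sval (ω y)) := by
    simp only [bdry, sum_sub_distrib]
  rw [key, hb, ← sum_neg_distrib]
  simp only [← sum_neg_distrib]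
  constructor <;> refine sum_le_sum fun x _ => sum_le_sum fun y _ => ?_ <;>
    have h0 : 0 ≤ sval (ω' y) - sval (ω y) := sub_nonneg.2 (sval_mono (h y)) <;>
    cases fill Q ω τ x <;> simp only [sval, if_true, if_false, Bool.false_eq_true] at h0 ⊢ <;>
    linarith

/-- The logarithm of a finite-volume probability, corrected by twice the boundary sum,
decreases in the boundary condition. -/
lemma log_ev_sub_bdry_antitone (hβ : 0 ≤ β) (Q : Finset (ℤ × ℤ)) (f : Cfg2 → ℝ)
    (hf : ∀ ω, 0 ≤ f ω) (hQ : ∀ ω ω' : Cfg2, (∀ x ∈ Q, ω x = ω' x) → f ω = f ω')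
    (hpos : ∀ ω, 0 < ev β Q ω f) :
    Antitone fun ω => Real.log (ev β Q ω f) - 2 * β * bdry Q ω := by
  intro ω ω' h
  set D := bdry Q ω' - bdry Q ω with hD
  have hfe : ∀ τ, f (fill Q ω' τ) = f (fill Q ω τ) := fun τ => hQ _ _ fun x hx => by
    simp [fill, hx]
  have hexp : ∀ τ, wt β Q (fill Q ω' τ) ≤ Real.exp (β * D) * wt β Q (fill Q ω τ) ∧
      wt β Q (fill Q ω τ) ≤ Real.exp (β * D) * wt β Q (fill Q ω' τ) := by
    intro τ
    obtain ⟨h1, h2⟩ := en_fill_sub_le Q h τ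
    simp only [wt, ← Real.exp_add, Real.exp_le_exp]
    constructor <;> nlinarith
  have hZ := partition_pos β Q ω
  have hZ' := partition_pos β Q ω'
  have hE := Real.exp_pos (β * D)
  have hn : ∑ η ∈ cfgs Q ω', wt β Q η * f η ≤
      Real.exp (β * D) * ∑ η ∈ cfgs Q ω, wt β Q η * f η := by
    rw [sum_cfgs Q ω' (fun η => wt β Q η * f η), sum_cfgs Q ω (fun η => wt β Q η * f η), mul_sum]
    refine sum_le_sum fun τ _ => ?_
    rw [hfe, ← mul_assoc]
    exact mul_le_mul_of_nonneg_right (hexp τ).1 (hf _)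
  have hz : ∑ η ∈ cfgs Q ω, wt β Q η ≤ Real.exp (β * D) * ∑ η ∈ cfgs Q ω', wt β Q η := by
    rw [sum_cfgs Q ω' (fun η => wt β Q η), sum_cfgs Q ω (fun η => wt β Q η), mul_sum]
    exact sum_le_sum fun τ _ => (hexp τ).2
  have hle : ev β Q ω' f ≤ Real.exp (2 * β * D) * ev β Q ω f := by
    have hn0 : 0 ≤ ∑ η ∈ cfgs Q ω, wt β Q η * f η :=
      sum_nonneg fun _ _ => mul_nonneg (wt_pos _ _ _).le (hf _)
    rw [ev, ev, ← mul_div_assoc, div_le_div_iff₀ hZ' hZ]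
    have : Real.exp (2 * β * D) = Real.exp (β * D) * Real.exp (β * D) := by
      rw [← Real.exp_add]; ring_nf
    rw [this]
    calc _ ≤ (Real.exp (β * D) * ∑ η ∈ cfgs Q ω, wt β Q η * f η) *
          (Real.exp (β * D) * ∑ η ∈ cfgs Q ω', wt β Q η) :=
        mul_le_mul hn hz hZ.le (mul_nonneg hE.le hn0)
      _ = _ := by ring
  have := Real.log_le_log (hpos ω') hle
  rw [Real.log_mul (Real.exp_pos _).ne' (hpos ω).ne', Real.log_exp] at this
  simp only
  nlinarith

end

end IsingLine

namespace IsingLine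

open Finset

noncomputable section

/-- Perron's theorem for a positive kernel on a finite type. -/
lemma exists_pos_eigenvector {ι : Type*} [Fintype ι] [Nonempty ι] (V : ι → ι → ℝ)
    (hV : ∀ i j, 0 < V i j) :
    ∃ (h : ι → ℝ) (l : ℝ), (∀ i, 0 < h i) ∧ 0 < l ∧ ∀ i, ∑ j, V i j * h j = l * h i := by
  classical
  set T : (ι → ℝ) → ι → ℝ := fun x i => ∑ j, V i j * x j with hT
  have Tpos : ∀ x : ι → ℝ, (∀ i, 0 ≤ x i) → (∃ i, 0 < x i) → ∀ i, 0 < T x i := by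
    rintro x hx ⟨k, hk⟩ i
    exact sum_pos' (fun j _ => mul_nonneg (hV i j).le (hx j)) ⟨k, mem_univ k, mul_pos (hV i k) hk⟩
  have Tcont : ∀ i, Continuous fun x => T x i := fun i => by
    simp only [hT]; fun_prop
  have Tcont' : Continuous T := continuous_pi Tcont
  have hsimp : ∀ x ∈ stdSimplex ℝ ι, ∃ i, 0 < x i := by
    intro x hx
    by_contra! h
    have := sum_nonpos fun i (_ : i ∈ univ) => h i
    linarith [hx.2]
  set g : (ι → ℝ) → ℝ := fun x => univ.inf' univ_nonempty fun i => T (T x) i / T x i with hg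
  have hgc : ContinuousOn g (stdSimplex ℝ ι) := by
    refine ContinuousOn.finset_inf'_apply _ fun i _ => ?_
    refine ContinuousOn.div ((Tcont i).comp Tcont').continuousOn (Tcont i).continuousOn ?_
    exact fun x hx => (Tpos x hx.1 (hsimp x hx) i).ne'
  obtain ⟨x, hx, hmax⟩ := (isCompact_stdSimplex ℝ ι).exists_isMaxOn
    ⟨_, single_mem_stdSimplex ℝ (Classical.arbitrary ι)⟩ hgc
  have hy := Tpos x hx.1 (hsimp x hx)
  have hz := Tpos (T x) (fun i => (hy i).le) ⟨Classical.arbitrary ι, hy _⟩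
  have hge : ∀ i, g x * T x i ≤ T (T x) i := fun i => by
    rw [← le_div_iff₀ (hy i)]
    exact inf'_le _ (mem_univ i)
  have hgpos : 0 < g x := by
    rw [hg, lt_inf'_iff]
    exact fun i _ => div_pos (hz i) (hy i)
  refine ⟨T x, g x, hy, hgpos, fun i => ?_⟩
  change T (T x) i = _
  by_contra hne
  have hstrict : ∀ k, g x * T (T x) k < T (T (T x)) k := by
    intro k
    have := Tpos (fun i => T (T x) i - g x * T x i) (fun i => sub_nonneg.2 (hge i))
      ⟨i, sub_pos.2 (lt_of_le_of_ne (hge i) (Ne.symm hne))⟩ k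
    have e : T (fun i => T (T x) i - g x * T x i) k = T (T (T x)) k - g x * T (T x) k := by
      simp only [hT, mul_sub, sum_sub_distrib, mul_sum]
      congr 1
      exact sum_congr rfl fun j _ => sum_congr rfl fun l _ => by ring
    linarith
  set N := ∑ i, T x i
  have hN : 0 < N := sum_pos (fun i _ => hy i) univ_nonempty
  have hw : (fun i => N⁻¹ * T x i) ∈ stdSimplex ℝ ι :=
    ⟨fun i => mul_nonneg (inv_pos.2 hN).le (hy i).le, by
      rw [← mul_sum]; exact inv_mul_cancel₀ hN.ne'⟩
  have hlin : ∀ (a : ℝ) (w : ι → ℝ), T (fun i => a * w i) = fun i => a * T w i := by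
    intro a w
    funext i
    simp only [hT, mul_sum]
    exact sum_congr rfl fun j _ => by ring
  have hgw : g (fun i => N⁻¹ * T x i) = univ.inf' univ_nonempty
      fun i => T (T (T x)) i / T (T x) i := by
    simp only [hg]
    congr 1
    funext i
    rw [hlin, hlin, mul_div_mul_left _ _ (inv_pos.2 hN).ne']
  have h1 : g (fun i => N⁻¹ * T x i) ≤ g x := hmax hw
  rw [hgw] at h1
  refine absurd h1 (not_le.2 ?_)
  rw [lt_inf'_iff]
  exact fun i _ => (lt_div_iff₀ (hz i)).2 (hstrict i)

set_option maxHeartbeats 1000000 in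
/-- Solvability of the boundary value problem for the fermionic modes forces a spectral gap. -/
lemma mode_gap {C S c s q : ℝ} {M : ℕ} (hM : 1 ≤ M) (x y r p : ℕ → ℝ)
    (hCS : C ^ 2 = 1 + S ^ 2) (hc : c = C ^ 2 + S ^ 2) (hs : s = 2 * C * S) (hC : 0 < C)
    (hs1 : 1 ≤ s) (hq : 0 < q) (hr : ∀ j, j ≤ M → r j = c * x j - s * y j)
    (hp : ∀ j, j ≤ M → p j = c * y j - s * x j)
    (h1 : ∀ i, i < M → c * y i - x (i + 1) = q * s * p i)
    (h2 : ∀ i, i < M → c * x (i + 1) - y i = q * s * r (i + 1))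
    (h0 : x 0 = q * r 0) (hMM : y M = q * p M) (hX : C * x 0 - S * y 0 < 0) :
    2 * (c ^ 2 / s) - 2 ≤ q + 1 / q := by
  have hs0 : 0 < s := by linarith
  set X : ℕ → ℝ := fun j => S * y j - C * x j with hXdef
  have hc2 : c ^ 2 = 1 + s ^ 2 := by
    rw [hc, hs]; linear_combination (C ^ 2 - S ^ 2 + 1) * hCS
  have hc0 : 0 < c := by rw [hc]; positivity
  have hC2 : 2 * C ^ 2 = c + 1 := by rw [hc]; linear_combination hCS
  have hS2 : 2 * S ^ 2 = c - 1 := by rw [hc]; linear_combination -hCS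
  have hcs : s ≤ c := by nlinarith
  have hcs1 : c ≤ s + 1 := by nlinarith
  have xr : ∀ j, j ≤ M → x j + r j = -(2 * C * X j) := fun j hj => by
    rw [hr j hj, hXdef]; simp only; linear_combination -x j * hC2 - y j * hs
  have yp : ∀ j, j ≤ M → y j - p j = -(2 * S * X j) := fun j hj => by
    rw [hp j hj, hXdef]; simp only; linear_combination y j * hS2 + x j * hs
  have Xrp : ∀ j, j ≤ M → -X j = C * r j + S * p j := fun j hj => by
    rw [hr j hj, hp j hj, hXdef]
    simp only
    rw [hs, hc]
    linear_combination (-C * x j + S * y j) * hCS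
  set L : ℕ → ℝ := fun j => s * q * r j + s * x j / q with hL
  set R : ℕ → ℝ := fun j => s * q * p j - s * y j / q with hR
  have main : ∀ j, j ≤ M → -(s * (q + 1 / q) * X j) = C * L j + S * R j := fun j hj => by
    have := Xrp j hj
    have e : -(s * (q + 1 / q) * X j) = s * q * (-X j) - s * (1 / q) * X j := by ring
    rw [e, this]
    simp only [hL, hR, hXdef]
    ring
  have L0 : L 0 = -(s * 2 * C * X 0) := by
    have e : s * x 0 / q = s * r 0 := by
      rw [h0]; field_simp
    have e' : L 0 = s * (x 0 + r 0) := by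
      simp only [hL]
      rw [e]
      linear_combination -s * h0
    rw [e', xr 0 (Nat.zero_le _)]; ring
  have RM : R M = -(s * 2 * S * X M) := by
    have e : s * y M / q = s * p M := by
      rw [hMM]; field_simp
    have e' : R M = s * (y M - p M) := by
      simp only [hR]
      rw [e]
      linear_combination -s * hMM
    rw [e', yp M le_rfl]; ring
  have Ls : ∀ i, i < M → L (i + 1) = -(c * 2 * C * X (i + 1)) + 2 * S * X i := fun i hi => by
    have e : s * x (i + 1) / q = c * r (i + 1) + p i := by
      rw [div_eq_iff hq.ne']
      have : s * (s * x (i + 1)) = s * ((c * r (i + 1) + p i) * q) := by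
        linear_combination h1 i hi + c * h2 i hi - x (i + 1) * hc2
      exact mul_left_cancel₀ hs0.ne' this
    have e1 := xr (i + 1) hi
    have e2 := yp i hi.le
    simp only [hL]
    rw [e]
    linear_combination -(h2 i hi) + c * e1 - e2
  have Rs : ∀ i, i < M → R i = -(c * 2 * S * X i) + 2 * C * X (i + 1) := fun i hi => by
    have e : s * y i / q = c * p i + r (i + 1) := by
      rw [div_eq_iff hq.ne']
      have : s * (s * y i) = s * ((c * p i + r (i + 1)) * q) := by
        linear_combination h2 i hi + c * h1 i hi - y i * hc2
      exact mul_left_cancel₀ hs0.ne' this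
    have e1 := xr (i + 1) hi
    have e2 := yp i hi.le
    simp only [hR]
    rw [e]
    linear_combination -(h1 i hi) + c * e2 - e1
  by_contra! hlt
  set Q := q + 1 / q with hQ
  have hQs : s * Q < 2 * c ^ 2 - 2 * s := by
    have : s * (2 * (c ^ 2 / s) - 2) = 2 * c ^ 2 - 2 * s := by field_simp
    rw [← this]
    exact mul_lt_mul_of_pos_left hlt hs0
  have hX0 : 0 < X 0 := by simp only [hXdef]; linarith
  have grow : ∀ j, j < M → 0 < X j ∧ X j < X (j + 1) := by
    intro j
    induction j with
    | zero =>
      intro h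
      refine ⟨hX0, ?_⟩
      have := main 0 (Nat.zero_le _)
      rw [L0, Rs 0 h] at this
      have e : s * X 1 = ((c + 1) * s + c * (c - 1) - s * Q) * X 0 := by
        rw [zero_add] at this
        linear_combination (-1) * this + s * X 0 * hC2 + c * X 0 * hS2 + X 1 * hs
      have e2 : s * X 0 < s * X 1 := by
        rw [e]
        refine mul_lt_mul_of_pos_right ?_ hX0
        linarith [mul_nonneg (sub_nonneg.2 hs1) (sub_nonneg.2 hcs1),
          mul_nonneg (sub_nonneg.2 hs1) (sub_nonneg.2 hcs)]
      exact lt_of_mul_lt_mul_left e2 hs0.le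
    | succ i ih =>
      intro h
      obtain ⟨h3, h4⟩ := ih (by omega)
      have hpos : 0 < X (i + 1) := h3.trans h4
      refine ⟨hpos, ?_⟩
      have := main (i + 1) h.le
      rw [Ls i (by omega), Rs (i + 1) h] at this
      have e : s * X (i + 1 + 1) = (c * (c + 1) + c * (c - 1) - s * Q) * X (i + 1) - s * X i := by
        linear_combination (-1) * this + c * X (i + 1) * hC2 + c * X (i + 1) * hS2
          + X (i + 1 + 1) * hs + X i * hs
      have e2 : s * X (i + 1) < s * X (i + 1 + 1) := by
        rw [e]
        have : 2 * s * X (i + 1) < (c * (c + 1) + c * (c - 1) - s * Q) * X (i + 1) :=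
          mul_lt_mul_of_pos_right (by linarith) hpos
        linarith [mul_lt_mul_of_pos_left h4 hs0]
      exact lt_of_mul_lt_mul_left e2 hs0.le
  obtain ⟨i, rfl⟩ : ∃ i, M = i + 1 := ⟨M - 1, by omega⟩
  obtain ⟨h3, h4⟩ := grow i (by omega)
  have hpos : 0 < X (i + 1) := h3.trans h4
  have := main (i + 1) le_rfl
  rw [Ls i (by omega), RM] at this
  have e : s * X i = (c * (c + 1) + s * (c - 1) - s * Q) * X (i + 1) := by
    linear_combination (-1) * this + c * X (i + 1) * hC2 + s * X (i + 1) * hS2 + X i * hs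
  have e2 : s * X (i + 1) < s * X i := by
    rw [e]
    refine mul_lt_mul_of_pos_right ?_ hpos
    linarith [mul_nonneg hc0.le (sub_nonneg.2 hcs1)]
  exact absurd (lt_of_mul_lt_mul_left e2 hs0.le) (not_lt.2 h4.le)

end

end IsingLine

namespace IsingLine

open Finset

noncomputable section

/-- The spins of a column of height `M`, with `ε` at the bottom end and plus above the top. -/
def sp {M : ℕ} (ε : ℝ) (s : Fin M → Bool) (j : ℕ) : ℝ :=
  if j = 0 then ε else if h : j - 1 < M then sval (s ⟨j - 1, h⟩) else 1

/-- The energy of the vertical bonds of a column. -/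
def colE {M : ℕ} (β ε : ℝ) (s : Fin M → Bool) : ℝ :=
  β * ∑ j ∈ range (M + 1), sp ε s j * sp ε s (j + 1)

/-- The Boltzmann weight of the horizontal bonds between two adjacent columns. -/
def horiz {M : ℕ} (β : ℝ) (s s' : Fin M → Bool) : ℝ :=
  Real.exp (β * ∑ i, sval (s i) * sval (s' i))

/-- Flip the lowest `j` spins of a column. -/
def flipTo {M : ℕ} (j : ℕ) (s : Fin M → Bool) : Fin M → Bool :=
  fun i => if i.1 < j then !s i else s i

variable {M : ℕ} {β : ℝ}

lemma flipTo_flipTo (j : ℕ) (s : Fin M → Bool) : flipTo j (flipTo j s) = s := by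
  funext i
  by_cases h : i.1 < j <;> simp [flipTo, h]

lemma sum_flipTo (j : ℕ) (F : (Fin M → Bool) → ℝ) : ∑ s, F (flipTo j s) = ∑ s, F s :=
  Equiv.sum_comp (Function.Involutive.toPerm (flipTo j) (flipTo_flipTo j)) F

lemma sp_flipTo {j : ℕ} (hj : j ≤ M) (s : Fin M → Bool) (k : ℕ) :
    sp 1 (flipTo j s) k = if k ≤ j then -sp (-1) s k else sp (-1) s k := by
  by_cases h0 : k = 0
  · simp [sp, h0]
  by_cases h1 : k - 1 < M
  · by_cases h2 : k ≤ j
    · have : k - 1 < j := by omega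
      simp [sp, h0, h1, h2, flipTo, this, sval_not]
    · have : ¬ k - 1 < j := by omega
      simp [sp, h0, h1, h2, flipTo, this]
  · have : ¬ k ≤ j := by omega
    simp [sp, h0, h1, this]

lemma colE_flipTo {j : ℕ} (hj : j ≤ M) (s : Fin M → Bool) :
    colE β (-1) s = colE β 1 (flipTo j s) + 2 * β * (sp (-1) s j * sp (-1) s (j + 1)) := by
  rw [colE, colE, ← sub_eq_iff_eq_add', ← mul_sub, ← sum_sub_distrib,
    sum_eq_single_of_mem j (by simp; omega)]
  · rw [sp_flipTo hj, sp_flipTo hj, if_pos le_rfl, if_neg (by omega)]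
    ring
  · intro k _ hk
    rw [sp_flipTo hj, sp_flipTo hj]
    rcases lt_or_gt_of_ne hk with h | h
    · rw [if_pos h.le, if_pos (show k + 1 ≤ j from h)]; ring
    · rw [if_neg (by omega), if_neg (by omega)]; ring

lemma sp_sq (s : Fin M → Bool) (j : ℕ) : sp (-1) s j * sp (-1) s j = 1 := by
  simp only [sp]
  split_ifs with h0 h1
  · norm_num
  · cases s ⟨j - 1, h1⟩ <;> norm_num [sval]
  · norm_num

lemma horiz_comm (s s' : Fin M → Bool) : horiz β s s' = horiz β s' s := by
  simp only [horiz, mul_comm]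

lemma horiz_flipTo (j : ℕ) (s s' : Fin M → Bool) :
    horiz β (flipTo j s) s' = horiz β s (flipTo j s') := by
  rw [horiz, horiz]
  congr 2
  refine sum_congr rfl fun i _ => ?_
  by_cases h : i.1 < j <;> simp [flipTo, h, sval_not]

lemma horiz_flipTo_succ (i : ℕ) (hi : i < M) (s s' : Fin M → Bool) :
    horiz β (flipTo i s) s' = horiz β (flipTo (i + 1) s) s' *
      Real.exp (2 * β * (sval (s ⟨i, hi⟩) * sval (s' ⟨i, hi⟩))) := by
  rw [horiz, horiz, ← Real.exp_add]
  congr 1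
  rw [← sub_eq_iff_eq_add', ← mul_sub, ← sum_sub_distrib,
    sum_eq_single_of_mem ⟨i, hi⟩ (mem_univ _)]
  · simp [flipTo, sval_not]; ring
  · intro k _ hk
    have : k.1 ≠ i := fun h => hk (Fin.ext h)
    by_cases h : k.1 < i
    · simp [flipTo, h, h.trans (Nat.lt_succ_self i)]
    · simp [flipTo, h, show ¬ k.1 < i + 1 by omega]

lemma exp_two_mul_spin (β : ℝ) {t : ℝ} (ht : t * t = 1) :
    Real.exp (2 * β * t) = Real.cosh (2 * β) + Real.sinh (2 * β) * t := by
  have : (t - 1) * (t + 1) = 0 := by linear_combination ht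
  rcases mul_eq_zero.1 this with h | h
  · rw [sub_eq_zero.1 h, mul_one, mul_one, Real.cosh_add_sinh]
  · rw [eq_neg_of_add_eq_zero_left h, mul_neg_one, mul_neg_one, ← sub_eq_add_neg,
      Real.cosh_sub_sinh]

/-- The pairing of the two Perron vectors through the fermion that flips the lowest `j` spins and
multiplies by the spin at `k`. -/
def pairing (w u v : (Fin M → Bool) → ℝ) (k j : ℕ) : ℝ :=
  ∑ s, w s * u s * (sp (-1) s k * v (flipTo j s))

lemma sum_kernel_comm (w u g : (Fin M → Bool) → ℝ) (l : ℝ)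
    (hu : ∀ s, ∑ s', horiz β s s' * (w s' * u s') = l * u s) :
    ∑ s, w s * u s * ∑ s', horiz β s s' * g s' = l * ∑ s, u s * g s := by
  simp only [mul_sum]
  rw [sum_comm]
  refine sum_congr rfl fun s' _ => ?_
  rw [← mul_assoc, ← hu, sum_mul]
  exact sum_congr rfl fun s _ => by rw [horiz_comm]; ring

lemma perron_ratio_gap (hβ : 0 < β) (hs : 1 ≤ Real.sinh (2 * β)) (hM : 1 ≤ M)
    (u v : (Fin M → Bool) → ℝ) (lm lp : ℝ) (hu0 : ∀ s, 0 < u s) (hv0 : ∀ s, 0 < v s)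
    (hlm : 0 < lm) (hlp : 0 < lp)
    (hu : ∀ s, ∑ s', horiz β s s' * (Real.exp (colE β (-1) s') * u s') = lm * u s)
    (hv : ∀ s, ∑ s', horiz β s s' * (Real.exp (colE β 1 s') * v s') = lp * v s) :
    2 * (Real.cosh (2 * β) ^ 2 / Real.sinh (2 * β)) - 2 ≤ lm / lp + 1 / (lm / lp) := by
  set c := Real.cosh (2 * β) with hc
  set s := Real.sinh (2 * β) with hsd
  have hs0 : 0 < s := by linarith
  have hc2 : c ^ 2 = 1 + s ^ 2 := by rw [hc, hsd, Real.cosh_sq]; ring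
  set w : (Fin M → Bool) → ℝ := fun η => Real.exp (colE β (-1) η) with hw
  set d : (Fin M → Bool) → ℝ := fun η => Real.exp (colE β 1 η) * v η with hd
  set r : ℕ → ℝ := fun j => ∑ η, u η * (sp (-1) η j * d (flipTo j η)) with hr
  set p : ℕ → ℝ := fun j => ∑ η, u η * (sp (-1) η (j + 1) * d (flipTo j η)) with hp
  set x : ℕ → ℝ := fun j => pairing w u v j j with hx
  set y : ℕ → ℝ := fun j => pairing w u v (j + 1) j with hy
  have hwd : ∀ j, j ≤ M → ∀ η, w η * v (flipTo j η) =
      (c + s * (sp (-1) η j * sp (-1) η (j + 1))) * d (flipTo j η) := by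
    intro j hj η
    simp only [hw, hd]
    rw [colE_flipTo hj, Real.exp_add, exp_two_mul_spin]
    · ring
    · calc _ = (sp (-1) η j * sp (-1) η j) * (sp (-1) η (j + 1) * sp (-1) η (j + 1)) := by ring
        _ = 1 := by rw [sp_sq, sp_sq, one_mul]
  have hxD : ∀ j, j ≤ M → x j = c * r j + s * p j := by
    intro j hj
    simp only [hx, hr, hp, pairing, mul_sum, ← sum_add_distrib]
    refine sum_congr rfl fun η _ => ?_
    have h1 := hwd j hj η
    have h2 := sp_sq η j
    linear_combination (u η * sp (-1) η j) * h1 +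
      u η * d (flipTo j η) * s * sp (-1) η (j + 1) * h2
  have hyD : ∀ j, j ≤ M → y j = c * p j + s * r j := by
    intro j hj
    simp only [hy, hr, hp, pairing, mul_sum, ← sum_add_distrib]
    refine sum_congr rfl fun η _ => ?_
    have h1 := hwd j hj η
    have h2 := sp_sq η (j + 1)
    linear_combination (u η * sp (-1) η (j + 1)) * h1 +
      u η * d (flipTo j η) * s * sp (-1) η j * h2
  have hv' : ∀ j η, lp * v (flipTo j η) = ∑ η', horiz β (flipTo j η) η' * d η' := fun j η => by
    rw [← hv]
  have hK : ∀ g : (Fin M → Bool) → ℝ, ∑ η, w η * u η * ∑ η', horiz β η η' * g η' =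
      lm * ∑ η, u η * g η := fun g => sum_kernel_comm w u g lm hu
  have hsp : ∀ (i : ℕ) (hi : i < M) (η : Fin M → Bool), sp (-1) η (i + 1) = sval (η ⟨i, hi⟩) :=
    fun i hi η => by simp [sp, hi]
  have hspM : ∀ η : Fin M → Bool, sp (-1) η (M + 1) = 1 := fun η => by simp [sp]
  have e1 : ∀ i, i < M → lp * (c * y i - x (i + 1)) = lm * s * p i := by
    intro i hi
    have : lm * p i = ∑ η, w η * u η * ∑ η', horiz β η η' *
        (sp (-1) η' (i + 1) * d (flipTo i η')) := (hK _).symm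
    calc _ = s * (lm * p i) := ?_
      _ = _ := by ring
    rw [this]
    simp only [hx, hy, pairing]
    rw [mul_sub, mul_left_comm, mul_sum, mul_sum, mul_sum, mul_sum, ← sum_sub_distrib]
    refine sum_congr rfl fun η _ => ?_
    have a1 : ∑ η', horiz β η η' * (sp (-1) η' (i + 1) * d (flipTo i η')) =
        ∑ η', horiz β (flipTo i η) η' * (sp (-1) η' (i + 1) * d η') := by
      rw [← sum_flipTo i fun η' => horiz β η η' * (sp (-1) η' (i + 1) * d (flipTo i η'))]
      refine sum_congr rfl fun η' _ => ?_
      rw [flipTo_flipTo, horiz_flipTo, hsp i hi, hsp i hi]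
      simp [flipTo]
    rw [a1]
    have a2 := hv' i η
    have a3 := hv' (i + 1) η
    have a4 : c * (∑ η', horiz β (flipTo i η) η' * d η') -
        (∑ η', horiz β (flipTo (i + 1) η) η' * d η') =
        s * (sp (-1) η (i + 1) *
          ∑ η', horiz β (flipTo i η) η' * (sp (-1) η' (i + 1) * d η')) := by
      simp only [mul_sum, ← sum_sub_distrib]
      refine sum_congr rfl fun η' _ => ?_
      rw [horiz_flipTo_succ i hi, exp_two_mul_spin, hsp i hi, hsp i hi]
      · have b1 : sval (η ⟨i, hi⟩) * sval (η ⟨i, hi⟩) = 1 := by rw [← hsp i hi, sp_sq]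
        have b2 : sval (η' ⟨i, hi⟩) * sval (η' ⟨i, hi⟩) = 1 := by rw [← hsp i hi, sp_sq]
        linear_combination (horiz β (flipTo (i + 1) η) η' * d η') * (hc2 -
          s ^ 2 * (sval (η' ⟨i, hi⟩) * sval (η' ⟨i, hi⟩)) * b1 - s ^ 2 * b2)
      · have b1 : sval (η ⟨i, hi⟩) * sval (η ⟨i, hi⟩) = 1 := by rw [← hsp i hi, sp_sq]
        have b2 : sval (η' ⟨i, hi⟩) * sval (η' ⟨i, hi⟩) = 1 := by rw [← hsp i hi, sp_sq]
        linear_combination (sval (η' ⟨i, hi⟩) * sval (η' ⟨i, hi⟩)) * b1 + b2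
    rw [← a2, ← a3] at a4
    have b := sp_sq η (i + 1)
    linear_combination (w η * u η * sp (-1) η (i + 1)) * a4 +
      (w η * u η * s * ∑ η', horiz β (flipTo i η) η' * (sp (-1) η' (i + 1) * d η')) * b
  have e2 : ∀ i, i < M → lp * (c * x (i + 1) - y i) = lm * s * r (i + 1) := by
    intro i hi
    have : lm * r (i + 1) = ∑ η, w η * u η * ∑ η', horiz β η η' *
        (sp (-1) η' (i + 1) * d (flipTo (i + 1) η')) := (hK _).symm
    calc _ = s * (lm * r (i + 1)) := ?_
      _ = _ := by ring
    rw [this]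
    simp only [hx, hy, pairing]
    rw [mul_sub, mul_left_comm, mul_sum, mul_sum, mul_sum, mul_sum, ← sum_sub_distrib]
    refine sum_congr rfl fun η _ => ?_
    have a1 : ∑ η', horiz β η η' * (sp (-1) η' (i + 1) * d (flipTo (i + 1) η')) =
        -∑ η', horiz β (flipTo (i + 1) η) η' * (sp (-1) η' (i + 1) * d η') := by
      rw [← sum_flipTo (i + 1) fun η' =>
        horiz β η η' * (sp (-1) η' (i + 1) * d (flipTo (i + 1) η')), ← sum_neg_distrib]
      refine sum_congr rfl fun η' _ => ?_
      rw [flipTo_flipTo, horiz_flipTo, hsp i hi, hsp i hi]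
      simp [flipTo, sval_not]
    rw [a1]
    have a2 := hv' i η
    have a3 := hv' (i + 1) η
    have a4 : c * (∑ η', horiz β (flipTo (i + 1) η) η' * d η') -
        (∑ η', horiz β (flipTo i η) η' * d η') =
        -(s * (sp (-1) η (i + 1) *
          ∑ η', horiz β (flipTo (i + 1) η) η' * (sp (-1) η' (i + 1) * d η'))) := by
      simp only [mul_sum, ← sum_sub_distrib, ← sum_neg_distrib]
      refine sum_congr rfl fun η' _ => ?_
      rw [horiz_flipTo_succ i hi, exp_two_mul_spin, hsp i hi, hsp i hi]
      · ring
      · have b1 : sval (η ⟨i, hi⟩) * sval (η ⟨i, hi⟩) = 1 := by rw [← hsp i hi, sp_sq]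
        have b2 : sval (η' ⟨i, hi⟩) * sval (η' ⟨i, hi⟩) = 1 := by rw [← hsp i hi, sp_sq]
        linear_combination (sval (η' ⟨i, hi⟩) * sval (η' ⟨i, hi⟩)) * b1 + b2
    rw [← a2, ← a3] at a4
    have b := sp_sq η (i + 1)
    linear_combination (w η * u η * sp (-1) η (i + 1)) * a4 -
      (w η * u η * s * ∑ η', horiz β (flipTo (i + 1) η) η' * (sp (-1) η' (i + 1) * d η')) * b
  have hf0 : ∀ η : Fin M → Bool, flipTo 0 η = η := fun η => by funext i; simp [flipTo]
  have hsp0 : ∀ η : Fin M → Bool, sp (-1) η 0 = -1 := fun η => by simp [sp]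
  have e0 : lp * x 0 = lm * r 0 := by
    simp only [hx, pairing, hr]
    rw [← hK (fun η => sp (-1) η 0 * d (flipTo 0 η)), mul_sum]
    refine sum_congr rfl fun η _ => ?_
    simp only [hsp0, hf0]
    have a := hv' 0 η
    rw [hf0] at a
    simp only [neg_mul, one_mul, mul_neg, sum_neg_distrib]
    linear_combination (-(w η * u η)) * a
  have eM : lp * y M = lm * p M := by
    simp only [hy, pairing, hp]
    rw [← hK (fun η => sp (-1) η (M + 1) * d (flipTo M η)), mul_sum]
    refine sum_congr rfl fun η _ => ?_
    simp only [hspM, one_mul]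
    have a := hv' M η
    have a1 : ∑ η', horiz β η η' * d (flipTo M η') = ∑ η', horiz β (flipTo M η) η' * d η' := by
      rw [← sum_flipTo M fun η' => horiz β η η' * d (flipTo M η')]
      exact sum_congr rfl fun η' _ => by rw [flipTo_flipTo, horiz_flipTo]
    rw [a1]
    linear_combination (w η * u η) * a
  have hsinh : 0 < Real.sinh β := Real.sinh_pos_iff.2 hβ
  refine mode_gap (C := Real.cosh β) (S := Real.sinh β) hM x y r p ?_ ?_ ?_ (Real.cosh_pos β) hs
    (div_pos hlm hlp) ?_ ?_ ?_ ?_ ?_ ?_ ?_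
  · rw [Real.cosh_sq]; ring
  · rw [hc, Real.cosh_two_mul]
  · rw [hsd, Real.sinh_two_mul]; ring
  · intro j hj
    linear_combination -c * hxD j hj + s * hyD j hj - r j * hc2
  · intro j hj
    linear_combination s * hxD j hj - c * hyD j hj - p j * hc2
  · intro i hi
    rw [div_mul_eq_mul_div, div_mul_eq_mul_div, eq_div_iff hlp.ne']
    linear_combination e1 i hi
  · intro i hi
    rw [div_mul_eq_mul_div, div_mul_eq_mul_div, eq_div_iff hlp.ne']
    linear_combination e2 i hi
  · rw [div_mul_eq_mul_div, eq_div_iff hlp.ne']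
    linear_combination e0
  · rw [div_mul_eq_mul_div, eq_div_iff hlp.ne']
    linear_combination eM
  · simp only [hx, hy, pairing, mul_sum, ← sum_sub_distrib]
    refine sum_neg (fun η _ => ?_) univ_nonempty
    simp only [hsp0, hf0]
    have b := hsp 0 hM η
    rw [zero_add] at b ⊢
    rw [b]
    have hpos : 0 < w η * u η * v η := mul_pos (mul_pos (Real.exp_pos _) (hu0 η)) (hv0 η)
    have hlt : Real.sinh β < Real.cosh β := Real.sinh_lt_cosh β
    cases η ⟨0, hM⟩ <;> simp only [sval, if_true, if_false, Bool.false_eq_true] <;> nlinarith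

end

end IsingLine

namespace IsingLine

open Finset

noncomputable section

/-- The segment of `k` consecutive sites of the line starting at `a`. -/
def seg (a : ℤ) (k : ℕ) : Finset (ℤ × ℤ) := Ico a (a + k) ×ˢ {0}

/-- The rectangle `[1,W] × [-H,H]`. -/
def rect (W H : ℕ) : Finset (ℤ × ℤ) := Icc 1 (W : ℤ) ×ˢ Icc (-(H : ℤ)) H

lemma mem_seg {a : ℤ} {k : ℕ} {x : ℤ × ℤ} : x ∈ seg a k ↔ (a ≤ x.1 ∧ x.1 < a + k) ∧ x.2 = 0 := by
  simp only [seg, mem_product, mem_Ico, mem_singleton]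

lemma mem_rect {W H : ℕ} {x : ℤ × ℤ} :
    x ∈ rect W H ↔ (1 ≤ x.1 ∧ x.1 ≤ W) ∧ -(H : ℤ) ≤ x.2 ∧ x.2 ≤ H := by
  simp [rect]

lemma seg_subset_rect (W H : ℕ) : seg 1 W ⊆ rect W H := fun x hx => by
  rw [mem_seg] at hx; rw [mem_rect]; omega

lemma sum_Icc_symm (H : ℕ) (g : ℤ → ℝ) : ∑ y ∈ Icc (-(H : ℤ)) H, g y =
    g 0 + ∑ i ∈ range H, (g (i + 1) + g (-(i + 1))) := by
  induction H with
  | zero => simp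
  | succ n ih =>
    have : Icc (-((n + 1 : ℕ) : ℤ)) ((n + 1 : ℕ) : ℤ) =
        insert ((n : ℤ) + 1) (insert (-((n : ℤ) + 1)) (Icc (-(n : ℤ)) n)) := by
      ext; simp only [mem_insert, mem_Icc]; omega
    rw [this, sum_insert, sum_insert, ih, sum_range_succ]
    · ring
    · simp
    · simp only [mem_insert, mem_Icc]; omega

lemma sum_Icc_symm' (H : ℕ) (g : ℤ → ℝ) : ∑ y ∈ Icc (-(H : ℤ) - 1) H, g y =
    ∑ j ∈ range (H + 1), (g j + g (-j - 1)) := by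
  induction H with
  | zero =>
    have : Icc (-((0 : ℕ) : ℤ) - 1) ((0 : ℕ) : ℤ) = {0, -1} := by decide
    rw [this, sum_pair (by decide)]
    simp
  | succ n ih =>
    have : Icc (-((n + 1 : ℕ) : ℤ) - 1) ((n + 1 : ℕ) : ℤ) =
        insert ((n : ℤ) + 1) (insert (-((n : ℤ) + 1) - 1) (Icc (-(n : ℤ) - 1) n)) := by
      ext; simp only [mem_insert, mem_Icc]; omega
    rw [this, sum_insert, sum_insert, ih, sum_range_succ _ (n + 1)]
    · push_cast; ring
    · simp only [mem_Icc]; omega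
    · simp only [mem_insert, mem_Icc]; omega

lemma sum_Icc_zero_nat (W : ℕ) (g : ℤ → ℝ) :
    ∑ x ∈ Icc (0 : ℤ) W, g x = ∑ x ∈ range (W + 1), g x := by
  induction W with
  | zero => simp
  | succ n ih =>
    have : Icc (0 : ℤ) ((n + 1 : ℕ) : ℤ) = insert ((n : ℤ) + 1) (Icc (0 : ℤ) n) := by
      ext; simp only [mem_insert, mem_Icc]; omega
    rw [this, sum_insert, ih, sum_range_succ _ (n + 1)]
    · push_cast; ring
    · simp

lemma sum_Icc_one_nat (W : ℕ) (g : ℤ → ℝ) :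
    ∑ x ∈ Icc (1 : ℤ) W, g x = ∑ x ∈ range W, g (x + 1) := by
  induction W with
  | zero => simp
  | succ n ih =>
    have : Icc (1 : ℤ) ((n + 1 : ℕ) : ℤ) = insert ((n : ℤ) + 1) (Icc (1 : ℤ) n) := by
      ext; simp only [mem_insert, mem_Icc]; omega
    rw [this, sum_insert, ih, sum_range_succ _ n]
    · ring
    · simp

lemma edges_rect {W H : ℕ} (hW : 1 ≤ W) : edges (rect W H) =
    (Icc (0 : ℤ) W ×ˢ Icc (-(H : ℤ)) H) ×ˢ {true} ∪
      (Icc (1 : ℤ) W ×ˢ Icc (-(H : ℤ) - 1) H) ×ˢ {false} := by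
  ext ⟨⟨x, y⟩, b⟩
  rw [mem_edges, mem_rect, mem_rect]
  cases b <;> simp [tip] <;> omega

lemma en_rect {W H : ℕ} (hW : 1 ≤ W) (ω : Cfg2) : en (rect W H) ω =
    (∑ x ∈ range (W + 1), (sval (ω (x, 0)) * sval (ω (x + 1, 0)) + ∑ i ∈ range H,
      (sval (ω (x, i + 1)) * sval (ω (x + 1, i + 1)) +
        sval (ω (x, -(i + 1))) * sval (ω (x + 1, -(i + 1)))))) +
    ∑ x ∈ range W, ∑ j ∈ range (H + 1), (sval (ω (x + 1, j)) * sval (ω (x + 1, j + 1)) +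
        sval (ω (x + 1, -j - 1)) * sval (ω (x + 1, -j))) := by
  rw [en, edges_rect hW, sum_union, sum_product, sum_product, sum_product, sum_product]
  · simp only [sum_singleton, bond, tip, if_true, Bool.false_eq_true, if_false]
    rw [sum_Icc_zero_nat W fun x => ∑ y ∈ Icc (-(H : ℤ)) H, sval (ω (x, y)) * sval (ω (x + 1, y)),
      sum_Icc_one_nat W fun x => ∑ y ∈ Icc (-(H : ℤ) - 1) H, sval (ω (x, y)) * sval (ω (x, y + 1))]
    congr 1
    · refine sum_congr rfl fun x _ => ?_
      rw [sum_Icc_symm H fun y => sval (ω (x, y)) * sval (ω (x + 1, y))]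
    · refine sum_congr rfl fun x _ => ?_
      rw [sum_Icc_symm' H fun y => sval (ω (x + 1, y)) * sval (ω (x + 1, y + 1))]
      simp
  · rw [disjoint_left]
    rintro ⟨x, b⟩ h1 h2
    simp only [mem_product, mem_singleton] at h1 h2
    simp [h1.2] at h2

/-- The spins above the line in column `x`. -/
def upc (H : ℕ) (x : ℤ) (ω : Cfg2) : Fin H → Bool := fun i => ω (x, (i : ℤ) + 1)

/-- The spins below the line in column `x`. -/
def lowc (H : ℕ) (x : ℤ) (ω : Cfg2) : Fin H → Bool := fun i => ω (x, -((i : ℤ) + 1))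

/-- The sites of the rectangle off the line. -/
def halves (W H : ℕ) : Finset (ℤ × ℤ) := Icc 1 (W : ℤ) ×ˢ (Icc (-(H : ℤ)) H).erase 0

lemma mem_halves {W H : ℕ} {x : ℤ × ℤ} :
    x ∈ halves W H ↔ (1 ≤ x.1 ∧ x.1 ≤ W) ∧ x.2 ≠ 0 ∧ -(H : ℤ) ≤ x.2 ∧ x.2 ≤ H := by
  simp [halves]

/-- The weight of the first `W` columns with the line frozen at `ε`. -/
def colwt (β ε : ℝ) (H W : ℕ) (ω : Cfg2) : ℝ :=
  ∏ x ∈ range W, ((horiz β (upc H x ω) (upc H (x + 1) ω) *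
      Real.exp (colE β ε (upc H (x + 1) ω))) *
    (horiz β (lowc H x ω) (lowc H (x + 1) ω) * Real.exp (colE β ε (lowc H (x + 1) ω))))

/-- Replace the spins off the line in column `x`. -/
def setcol {H : ℕ} (x : ℤ) (s t : Fin H → Bool) (ω : Cfg2) : Cfg2 := fun p =>
  if p.1 = x then
    if h : 1 ≤ p.2 ∧ p.2 ≤ H then s ⟨(p.2 - 1).toNat, by omega⟩
    else if h : -(H : ℤ) ≤ p.2 ∧ p.2 ≤ -1 then t ⟨(-p.2 - 1).toNat, by omega⟩ else ω p
  else ω p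

/-- The sites off the line in column `x`. -/
def colSites (H : ℕ) (x : ℤ) : Finset (ℤ × ℤ) := {x} ×ˢ (Icc (-(H : ℤ)) H).erase 0

lemma upc_setcol {H : ℕ} (x : ℤ) (s t : Fin H → Bool) (ω : Cfg2) :
    upc H x (setcol x s t ω) = s := by
  funext i
  have := i.2
  simp only [upc, setcol, if_true]
  rw [dif_pos (by omega)]
  congr 1
  ext
  simp

lemma lowc_setcol {H : ℕ} (x : ℤ) (s t : Fin H → Bool) (ω : Cfg2) :
    lowc H x (setcol x s t ω) = t := by
  funext i
  have := i.2
  simp only [lowc, setcol, if_true]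
  rw [dif_neg (by omega), dif_pos (by omega)]
  congr 1
  ext
  simp

lemma sum_cfgs_colSites {H : ℕ} (x : ℤ) (ω : Cfg2) (F : Cfg2 → ℝ) :
    ∑ η ∈ cfgs (colSites H x) ω, F η =
      ∑ s : Fin H → Bool, ∑ t : Fin H → Bool, F (setcol x s t ω) := by
  rw [← sum_product']
  refine sum_bij' (fun η _ => (upc H x η, lowc H x η)) (fun p _ => setcol x p.1 p.2 ω)
    ?_ ?_ ?_ ?_ ?_
  · intro η _; simp
  · rintro ⟨s, t⟩ _
    rw [mem_cfgs]
    rintro ⟨a, b⟩ hp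
    simp only [colSites, mem_product, mem_singleton, mem_erase, mem_Icc] at hp
    simp only [setcol]
    split_ifs with h1 h2 h3
    · exact absurd ⟨h1, by omega⟩ hp
    · exact absurd ⟨h1, by omega⟩ hp
    · rfl
    · rfl
  · intro η hη
    rw [mem_cfgs] at hη
    funext ⟨a, b⟩
    simp only [setcol, upc, lowc]
    split_ifs with h1 h2 h3
    · congr 1; ext <;> simp <;> omega
    · congr 1; ext <;> simp <;> omega
    · refine (hη _ ?_).symm
      simp only [colSites, mem_product, mem_singleton, mem_erase, mem_Icc]
      omega
    · refine (hη _ ?_).symm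
      simp only [colSites, mem_product, mem_singleton, mem_erase, mem_Icc]
      omega
  · rintro ⟨s, t⟩ _
    simp [upc_setcol, lowc_setcol]
  · intro η hη
    congr 1
    rw [mem_cfgs] at hη
    funext ⟨a, b⟩
    simp only [setcol, upc, lowc]
    split_ifs with h1 h2 h3
    · congr 1; ext <;> simp <;> omega
    · congr 1; ext <;> simp <;> omega
    · refine (hη _ ?_)
      simp only [colSites, mem_product, mem_singleton, mem_erase, mem_Icc]
      omega
    · refine (hη _ ?_)
      simp only [colSites, mem_product, mem_singleton, mem_erase, mem_Icc]
      omega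

lemma sum_cfgs_union {Λ Δ : Finset (ℤ × ℤ)} (h : Disjoint Λ Δ) (σ : Cfg2) (F : Cfg2 → ℝ) :
    ∑ η ∈ cfgs (Λ ∪ Δ) σ, F η = ∑ ω ∈ cfgs Λ σ, ∑ η ∈ cfgs Δ ω, F η := by
  classical
  rw [sum_sigma']
  symm
  refine sum_bij' (fun p _ => p.2) (fun η _ => ⟨Δ.piecewise σ η, η⟩) ?_ ?_ ?_ ?_ ?_
  · rintro ⟨ω, η⟩ hp
    simp only [mem_sigma, mem_cfgs] at hp ⊢
    intro x hx
    rw [mem_union, not_or] at hx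
    rw [hp.2 x hx.2, hp.1 x hx.1]
  · intro η hη
    simp only [mem_sigma, mem_cfgs] at hη ⊢
    refine ⟨fun x hx => ?_, fun x hx => by simp [hx]⟩
    by_cases hxD : x ∈ Δ
    · simp [hxD]
    · simp [hxD, hη x (by simp [hx, hxD])]
  · rintro ⟨ω, η⟩ hp
    simp only [mem_sigma, mem_cfgs] at hp
    have : Δ.piecewise σ η = ω := by
      funext x
      by_cases hxD : x ∈ Δ
      · simp only [hxD, piecewise_eq_of_mem]
        exact (hp.1 x fun hx => disjoint_left.1 h hx hxD).symm
      · simp [hxD, hp.2 x hxD]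
    simp [this]
  · intro η _; rfl
  · intro p _; rfl

lemma halves_succ (W H : ℕ) : halves (W + 1) H = halves W H ∪ colSites H ((W : ℤ) + 1) := by
  ext ⟨x, y⟩
  rw [mem_union, mem_halves, mem_halves]
  simp only [colSites, mem_product, mem_singleton, mem_erase, mem_Icc]
  push_cast
  omega

lemma sum_colwt {β ε l : ℝ} {H : ℕ} (h : (Fin H → Bool) → ℝ)
    (hh : ∀ s, ∑ s', horiz β s s' * (Real.exp (colE β ε s') * h s') = l * h s) (W : ℕ) (σ : Cfg2) :
    ∑ ω ∈ cfgs (halves W H) σ, colwt β ε H W ω * (h (upc H W ω) * h (lowc H W ω)) =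
      (l ^ 2) ^ W * (h (upc H 0 σ) * h (lowc H 0 σ)) := by
  induction W with
  | zero =>
    have : cfgs (halves 0 H) σ = {σ} := by
      ext ω
      have h0 : halves 0 H = ∅ := by
        ext x; rw [mem_halves]; simp; omega
      rw [mem_cfgs, mem_singleton, h0]
      simp [funext_iff]
    rw [this, sum_singleton]
    simp [colwt]
  | succ W ih =>
    rw [halves_succ, sum_cfgs_union, pow_succ', mul_assoc, ← ih, mul_sum]
    · refine sum_congr rfl fun ω _ => ?_
      rw [sum_cfgs_colSites]
      have hu : ∀ s t : Fin H → Bool, ∀ x : ℤ, x ≠ (W : ℤ) + 1 →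
          upc H x (setcol ((W : ℤ) + 1) s t ω) = upc H x ω := fun s t x hx => by
        funext i; simp [upc, setcol, hx]
      have hl : ∀ s t : Fin H → Bool, ∀ x : ℤ, x ≠ (W : ℤ) + 1 →
          lowc H x (setcol ((W : ℤ) + 1) s t ω) = lowc H x ω := fun s t x hx => by
        funext i; simp [lowc, setcol, hx]
      have hc : ∀ s t : Fin H → Bool, colwt β ε H (W + 1) (setcol ((W : ℤ) + 1) s t ω) =
          colwt β ε H W ω * ((horiz β (upc H W ω) s * Real.exp (colE β ε s)) *
            (horiz β (lowc H W ω) t * Real.exp (colE β ε t))) := by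
        intro s t
        rw [colwt, prod_range_succ, upc_setcol, lowc_setcol, hu _ _ _ (by omega),
          hl _ _ _ (by omega)]
        congr 1
        refine prod_congr rfl fun x hx => ?_
        rw [mem_range] at hx
        rw [hu _ _ _ (by omega), hu _ _ _ (by omega), hl _ _ _ (by omega), hl _ _ _ (by omega)]
      push_cast
      simp only [hc, upc_setcol, lowc_setcol]
      have e : colwt β ε H W ω * ((l * h (upc H W ω)) * (l * h (lowc H W ω))) =
          l ^ 2 * (colwt β ε H W ω * (h (upc H W ω) * h (lowc H W ω))) := by ring
      rw [← e, ← hh, ← hh, sum_mul_sum, mul_sum]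
      refine sum_congr rfl fun s _ => ?_
      rw [mul_sum]
      exact sum_congr rfl fun t _ => by ring
    · rw [disjoint_left]
      intro x h1 h2
      rw [mem_halves] at h1
      simp only [colSites, mem_product, mem_singleton, mem_erase, mem_Icc] at h2
      omega

/-- Plus configuration with the segment `[1,W]` of the line set to `b`. -/
def rowCfg (W : ℕ) (b : Bool) : Cfg2 := (seg 1 W).piecewise (fun _ => b) plus

lemma wt_rect {β : ℝ} {W H : ℕ} (hW : 1 ≤ W) (b : Bool) {ω : Cfg2}
    (hω : ω ∈ cfgs (halves W H) (rowCfg W b)) : wt β (rect W H) ω =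
      Real.exp (β * (W - 1 + 2 * sval b)) * (colwt β (sval b) H W ω *
        (horiz β (upc H W ω) (fun _ => true) * horiz β (lowc H W ω) (fun _ => true))) := by
  rw [mem_cfgs] at hω
  have hout : ∀ x : ℤ × ℤ, x ∉ rect W H → ω x = true := by
    intro x hx
    rw [mem_rect] at hx
    rw [hω x (by rw [mem_halves]; omega), rowCfg, piecewise_eq_of_notMem]
    rw [mem_seg]; omega
  have hrow : ∀ x : ℤ, 1 ≤ x → x ≤ W → ω (x, 0) = b := by
    intro x h1 h2
    rw [hω _ (by rw [mem_halves]; omega), rowCfg, piecewise_eq_of_mem]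
    rw [mem_seg]; omega
  have hr : ∑ x ∈ range (W + 1), sval (ω (x, 0)) * sval (ω (x + 1, 0)) = W - 1 + 2 * sval b := by
    obtain ⟨k, rfl⟩ : ∃ k, W = k + 1 := ⟨W - 1, by omega⟩
    rw [sum_range_succ, sum_range_succ']
    have e1 : ∑ x ∈ range k, sval (ω (((x + 1 : ℕ) : ℤ), 0)) *
        sval (ω (((x + 1 : ℕ) : ℤ) + 1, 0)) = k := by
      rw [sum_congr rfl (g := fun _ => (1 : ℝ))]
      · simp
      · intro x hx
        rw [mem_range] at hx
        rw [hrow _ (by omega) (by omega), hrow _ (by omega) (by omega)]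
        cases b <;> simp [sval]
    rw [e1, hrow ((k + 1 : ℕ) : ℤ) (by omega) (by omega), hout (((k + 1 : ℕ) : ℤ) + 1, 0)
      (by rw [mem_rect]; simp), hout (((0 : ℕ) : ℤ), 0) (by rw [mem_rect]; simp),
      hrow (((0 : ℕ) : ℤ) + 1) (by simp) (by simp)]
    have : sval true = 1 := by simp [sval]
    rw [this]
    push_cast
    ring
  have hh1 : ∀ x x' : ℤ, β * ∑ i ∈ range H, sval (ω (x, i + 1)) * sval (ω (x', i + 1)) =
      Real.log (horiz β (upc H x ω) (upc H x' ω)) := fun x x' => by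
    rw [horiz, Real.log_exp, ← Fin.sum_univ_eq_sum_range
      (fun i => sval (ω (x, (i : ℤ) + 1)) * sval (ω (x', (i : ℤ) + 1)))]
    rfl
  have hh2 : ∀ x x' : ℤ, β * ∑ i ∈ range H, sval (ω (x, -(i + 1))) * sval (ω (x', -(i + 1))) =
      Real.log (horiz β (lowc H x ω) (lowc H x' ω)) := fun x x' => by
    rw [horiz, Real.log_exp, ← Fin.sum_univ_eq_sum_range
      (fun i => sval (ω (x, -((i : ℤ) + 1))) * sval (ω (x', -((i : ℤ) + 1))))]
    rfl
  have hsu : ∀ x : ℕ, x < W → ∀ j : ℕ, j ≤ H + 1 →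
      sp (sval b) (upc H (x + 1) ω) j = sval (ω ((x : ℤ) + 1, j)) := by
    intro x hx j hj
    rcases Nat.eq_zero_or_pos j with rfl | hj0
    · simp [sp, hrow ((x : ℤ) + 1) (by omega) (by omega)]
    · have h0 : j ≠ 0 := by omega
      simp only [sp, h0, if_false, upc]
      split_ifs with h
      · congr 3; omega
      · rw [hout _ (by rw [mem_rect]; simp only; omega)]; simp [sval]
  have hsl : ∀ x : ℕ, x < W → ∀ j : ℕ, j ≤ H + 1 →
      sp (sval b) (lowc H (x + 1) ω) j = sval (ω ((x : ℤ) + 1, -j)) := by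
    intro x hx j hj
    rcases Nat.eq_zero_or_pos j with rfl | hj0
    · simp [sp, hrow ((x : ℤ) + 1) (by omega) (by omega)]
    · have h0 : j ≠ 0 := by omega
      simp only [sp, h0, if_false, lowc]
      split_ifs with h
      · congr 3; omega
      · rw [hout _ (by rw [mem_rect]; simp only; omega)]; simp [sval]
  have hv : ∀ x ∈ range W, β * ∑ j ∈ range (H + 1),
      (sval (ω ((x : ℤ) + 1, j)) * sval (ω ((x : ℤ) + 1, j + 1)) +
        sval (ω ((x : ℤ) + 1, -j - 1)) * sval (ω ((x : ℤ) + 1, -j))) =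
      colE β (sval b) (upc H (x + 1) ω) + colE β (sval b) (lowc H (x + 1) ω) := by
    intro x hx
    rw [mem_range] at hx
    rw [colE, colE, ← mul_add, ← sum_add_distrib]
    congr 1
    refine sum_congr rfl fun j hj => ?_
    rw [mem_range] at hj
    rw [hsu x hx j (by omega), hsu x hx (j + 1) (by omega), hsl x hx j (by omega),
      hsl x hx (j + 1) (by omega)]
    push_cast
    rw [neg_add, ← sub_eq_add_neg]
    ring
  have hlast : upc H ((W : ℤ) + 1) ω = (fun _ => true) ∧ lowc H ((W : ℤ) + 1) ω = fun _ => true :=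
    ⟨funext fun i => hout _ (by rw [mem_rect]; simp),
      funext fun i => hout _ (by rw [mem_rect]; simp)⟩
  have hpos : ∀ s t : Fin H → Bool, 0 < horiz β s t := fun _ _ => Real.exp_pos _
  have hcol : Real.log (colwt β (sval b) H W ω) = ∑ x ∈ range W,
      ((Real.log (horiz β (upc H x ω) (upc H (x + 1) ω)) + colE β (sval b) (upc H (x + 1) ω)) +
      (Real.log (horiz β (lowc H x ω) (lowc H (x + 1) ω)) +
        colE β (sval b) (lowc H (x + 1) ω))) := by
    rw [colwt, Real.log_prod]
    · refine sum_congr rfl fun x _ => ?_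
      rw [Real.log_mul (mul_pos (hpos _ _) (Real.exp_pos _)).ne'
        (mul_pos (hpos _ _) (Real.exp_pos _)).ne', Real.log_mul (hpos _ _).ne' (Real.exp_pos _).ne',
        Real.log_mul (hpos _ _).ne' (Real.exp_pos _).ne', Real.log_exp, Real.log_exp]
    · intro x _
      exact (mul_pos (mul_pos (hpos _ _) (Real.exp_pos _))
        (mul_pos (hpos _ _) (Real.exp_pos _))).ne'
  have hcpos : 0 < colwt β (sval b) H W ω := prod_pos fun x _ =>
    mul_pos (mul_pos (hpos _ _) (Real.exp_pos _)) (mul_pos (hpos _ _) (Real.exp_pos _))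
  rw [← Real.exp_log (mul_pos hcpos (mul_pos (hpos (upc H W ω) (fun _ => true))
    (hpos (lowc H W ω) (fun _ => true)))), ← Real.exp_add, wt,
    Real.log_mul hcpos.ne' (mul_pos (hpos _ _) (hpos _ _)).ne',
    Real.log_mul (hpos _ _).ne' (hpos _ _).ne', hcol]
  congr 1
  rw [en_rect hW, sum_add_distrib, hr, mul_add, mul_add]
  have hH : β * ∑ x ∈ range (W + 1), ∑ i ∈ range H,
      (sval (ω (x, i + 1)) * sval (ω (x + 1, i + 1)) +
        sval (ω (x, -(i + 1))) * sval (ω (x + 1, -(i + 1)))) =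
      (∑ x ∈ range W, (Real.log (horiz β (upc H x ω) (upc H (x + 1) ω)) +
        Real.log (horiz β (lowc H x ω) (lowc H (x + 1) ω)))) +
      (Real.log (horiz β (upc H W ω) fun _ => true) +
        Real.log (horiz β (lowc H W ω) fun _ => true)) := by
    rw [mul_sum, sum_range_succ]
    congr 1
    · refine sum_congr rfl fun x _ => ?_
      rw [sum_add_distrib, mul_add, hh1, hh2]
    · rw [sum_add_distrib, mul_add, hh1, hh2, hlast.1, hlast.2]
  rw [hH, mul_sum (range W), sum_congr rfl hv]
  simp only [sum_add_distrib]
  ring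

end

end IsingLine

namespace IsingLine

open Finset

noncomputable section

lemma one_lt_sinh {β : ℝ} (hβ : betaCrit < β) : 1 < Real.sinh (2 * β) := by
  have h2 : (0 : ℝ) < 1 + Real.sqrt 2 := by positivity
  have h1 : Real.sinh (Real.log (1 + Real.sqrt 2)) = 1 := by
    rw [Real.sinh_eq, Real.exp_neg, Real.exp_log h2]
    have := Real.sq_sqrt (show (0 : ℝ) ≤ 2 by norm_num)
    field_simp
    nlinarith
  rw [← h1]
  refine Real.sinh_lt_sinh.2 ?_
  rw [betaCrit] at hβ
  linarith

lemma betaCrit_pos : 0 < betaCrit := by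
  rw [betaCrit]
  have : 0 < Real.sqrt 2 := by positivity
  exact half_pos (Real.log_pos (by linarith))

lemma sum_cyl_seg (β : ℝ) (W H : ℕ) (b : Bool) :
    ∑ ω ∈ cfgs (rect W H) plus, wt β (rect W H) ω * cyl (seg 1 W) (fun _ => b) ω =
      ∑ ω ∈ cfgs (halves W H) (rowCfg W b), wt β (rect W H) ω := by
  classical
  have : cfgs (halves W H) (rowCfg W b) =
      (cfgs (rect W H) plus).filter fun ω => ∀ x ∈ seg 1 W, ω x = b := by
    ext ω
    simp only [mem_cfgs, mem_filter]
    constructor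
    · intro h
      refine ⟨fun x hx => ?_, fun x hx => ?_⟩
      · rw [mem_rect] at hx
        rw [h x (by rw [mem_halves]; omega), rowCfg, piecewise_eq_of_notMem]
        rw [mem_seg]; omega
      · rw [mem_seg] at hx
        rw [h x (by rw [mem_halves]; omega), rowCfg, piecewise_eq_of_mem]
        rw [mem_seg]; omega
    · rintro ⟨h1, h2⟩ x hx
      by_cases hs : x ∈ seg 1 W
      · rw [h2 x hs, rowCfg, piecewise_eq_of_mem _ _ _ hs]
      · rw [rowCfg, piecewise_eq_of_notMem _ _ _ hs]
        refine h1 x ?_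
        rw [mem_rect]
        rw [mem_halves] at hx
        rw [mem_seg] at hs
        omega
  rw [this, sum_filter]
  refine sum_congr rfl fun ω _ => ?_
  rw [cyl]
  split_ifs <;> simp

lemma sum_rect_bounds {β : ℝ} {H : ℕ} (b : Bool) (h : (Fin H → Bool) → ℝ) {l : ℝ}
    (h0 : ∀ s, 0 < h s)
    (hh : ∀ s, ∑ s', horiz β s s' * (Real.exp (colE β (sval b) s') * h s') = l * h s) :
    ∃ A B : ℝ, 0 < A ∧ 0 < B ∧ ∀ W : ℕ, 1 ≤ W →
      A * (Real.exp (β * (W - 1)) * (l ^ 2) ^ W) ≤ ∑ ω ∈ cfgs (rect W H) plus,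
        wt β (rect W H) ω * cyl (seg 1 W) (fun _ => b) ω ∧
      ∑ ω ∈ cfgs (rect W H) plus,
        wt β (rect W H) ω * cyl (seg 1 W) (fun _ => b) ω ≤
          B * (Real.exp (β * (W - 1)) * (l ^ 2) ^ W) := by
  set k : (Fin H → Bool) → ℝ := fun s => horiz β s (fun _ => true) / h s with hk
  have hk0 : ∀ s, 0 < k s := fun s => div_pos (Real.exp_pos _) (h0 s)
  obtain ⟨s1, hs1⟩ := Finite.exists_min k
  obtain ⟨s2, hs2⟩ := Finite.exists_max k
  have hhk : ∀ s, horiz β s (fun _ => true) = k s * h s := fun s => by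
    rw [hk]; field_simp [(h0 s).ne']
  set t : Fin H → Bool := fun _ => true with ht
  have key : ∀ W : ℕ, 1 ≤ W → ∑ ω ∈ cfgs (rect W H) plus,
        wt β (rect W H) ω * cyl (seg 1 W) (fun _ => b) ω =
      Real.exp (β * (2 * sval b)) * Real.exp (β * (W - 1)) *
        ∑ ω ∈ cfgs (halves W H) (rowCfg W b), (k (upc H W ω) * k (lowc H W ω)) *
        (colwt β (sval b) H W ω * (h (upc H W ω) * h (lowc H W ω))) := by
    intro W hW
    rw [sum_cyl_seg, mul_sum]
    refine sum_congr rfl fun ω hω => ?_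
    rw [wt_rect hW b hω, ← Real.exp_add, hhk, hhk]
    rw [show β * (W - 1 + 2 * sval b) = β * (2 * sval b) + β * (W - 1) by ring]
    ring
  have hcw : ∀ W (ω : Cfg2), 0 < colwt β (sval b) H W ω * (h (upc H W ω) * h (lowc H W ω)) :=
    fun W ω => mul_pos (prod_pos fun x _ => mul_pos (mul_pos (Real.exp_pos _) (Real.exp_pos _))
      (mul_pos (Real.exp_pos _) (Real.exp_pos _))) (mul_pos (h0 _) (h0 _))
  have hrow : ∀ W : ℕ, upc H 0 (rowCfg W b) = t ∧ lowc H 0 (rowCfg W b) = t := fun W => by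
    constructor <;> funext i
    · rw [upc, rowCfg, piecewise_eq_of_notMem]
      rw [mem_seg]; simp
    · rw [lowc, rowCfg, piecewise_eq_of_notMem]
      rw [mem_seg]; simp
  set e := Real.exp (β * (2 * sval b)) with he
  have he0 : 0 < e := Real.exp_pos _
  refine ⟨e * (k s1 * k s1) * (h t * h t), e * (k s2 * k s2) * (h t * h t), ?_, ?_, ?_⟩
  · exact mul_pos (mul_pos he0 (mul_pos (hk0 _) (hk0 _))) (mul_pos (h0 _) (h0 _))
  · exact mul_pos (mul_pos he0 (mul_pos (hk0 _) (hk0 _))) (mul_pos (h0 _) (h0 _))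
  intro W hW
  have hS := sum_colwt h hh W (rowCfg W b)
  rw [(hrow W).1, (hrow W).2] at hS
  have hE : 0 < e * Real.exp (β * (W - 1)) := mul_pos he0 (Real.exp_pos _)
  rw [key W hW]
  constructor
  · have : (k s1 * k s1) * ((l ^ 2) ^ W * (h t * h t)) ≤
        ∑ ω ∈ cfgs (halves W H) (rowCfg W b), (k (upc H W ω) * k (lowc H W ω)) *
        (colwt β (sval b) H W ω * (h (upc H W ω) * h (lowc H W ω))) := by
      rw [← hS, mul_sum]
      exact sum_le_sum fun ω _ => mul_le_mul_of_nonneg_right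
        (mul_le_mul (hs1 _) (hs1 _) (hk0 _).le (hk0 _).le) (hcw W ω).le
    have := mul_le_mul_of_nonneg_left this hE.le
    linarith
  · have : ∑ ω ∈ cfgs (halves W H) (rowCfg W b), (k (upc H W ω) * k (lowc H W ω)) *
        (colwt β (sval b) H W ω * (h (upc H W ω) * h (lowc H W ω))) ≤
        (k s2 * k s2) * ((l ^ 2) ^ W * (h t * h t)) := by
      rw [← hS, mul_sum]
      exact sum_le_sum fun ω _ => mul_le_mul_of_nonneg_right
        (mul_le_mul (hs2 _) (hs2 _) (hk0 _).le (hk0 _).le) (hcw W ω).le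
    have := mul_le_mul_of_nonneg_left this hE.le
    linarith

lemma cyl_flip (T : Finset (ℤ × ℤ)) (ω : Cfg2) :
    cyl T (fun _ => false) (flip ω) = cyl T plus ω := by
  rw [cyl, cyl]
  exact if_congr (forall₂_congr fun x _ => by simp [flip]) rfl rfl

lemma ev_cyl_minus_le_plus {β : ℝ} (hβ : 0 ≤ β) (Λ T : Finset (ℤ × ℤ)) :
    ev β Λ plus (cyl T fun _ => false) ≤ ev β Λ plus (cyl T plus) := by
  refine (ev_anti hβ (le_plus (flip plus)) (cyl_minus_anti T)).trans ?_
  rw [ev_flip]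
  simp only [cyl_flip]
  exact le_rfl

/-- Exponential cost, uniform in the height of the rectangle, of a minus row compared to a
plus row. -/
theorem exists_row_cost {β : ℝ} (hβ : betaCrit < β) : ∃ θ : ℝ, 0 < θ ∧ θ < 1 ∧ ∀ H : ℕ, 1 ≤ H →
    ∃ C : ℝ, 0 < C ∧ ∀ W : ℕ, 1 ≤ W → ev β (rect W H) plus (cyl (seg 1 W) fun _ => false) ≤
      C * θ ^ W * ev β (rect W H) plus (cyl (seg 1 W) plus) := by
  have hs := one_lt_sinh hβ
  have hβ0 : 0 < β := betaCrit_pos.trans hβ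
  set s := Real.sinh (2 * β) with hsd
  have hc2 : Real.cosh (2 * β) ^ 2 / s = s + 1 / s := by
    rw [Real.cosh_sq]; field_simp; rw [hsd]
  have hD : 1 < 2 * (s + 1 / s) - 3 := by
    have : 2 < s + 1 / s := by
      have h0 : 0 < s := by linarith
      rw [show s + 1 / s = 2 + (s - 1) ^ 2 / s by field_simp; ring]
      have : 0 < (s - 1) ^ 2 / s := div_pos (pow_pos (by linarith) 2) h0
      linarith
    linarith
  set D := 2 * (s + 1 / s) - 3 with hDd
  refine ⟨(1 / D) ^ 2, by positivity, ?_, fun H hH => ?_⟩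
  · have : 1 / D < 1 := by rw [div_lt_one (by linarith)]; exact hD
    exact pow_lt_one₀ (by positivity) this (by norm_num)
  obtain ⟨u, lm, hu0, hlm, hu⟩ := exists_pos_eigenvector
    (fun s s' : Fin H → Bool => horiz β s s' * Real.exp (colE β (-1) s'))
    (fun s s' => mul_pos (Real.exp_pos _) (Real.exp_pos _))
  obtain ⟨v, lp, hv0, hlp, hv⟩ := exists_pos_eigenvector
    (fun s s' : Fin H → Bool => horiz β s s' * Real.exp (colE β 1 s'))
    (fun s s' => mul_pos (Real.exp_pos _) (Real.exp_pos _))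
  simp only [mul_assoc] at hu hv
  have gap := perron_ratio_gap hβ0 hs.le hH u v lm lp hu0 hv0 hlm hlp hu hv
  rw [hc2] at gap
  obtain ⟨A1, B1, hA1, hB1, h1⟩ := sum_rect_bounds (β := β) false u (l := lm) hu0
    (by simpa [sval] using hu)
  obtain ⟨A2, B2, hA2, hB2, h2⟩ := sum_rect_bounds (β := β) true v (l := lp) hv0
    (by simpa [sval] using hv)
  set q := lm / lp with hq
  have hq0 : 0 < q := div_pos hlm hlp
  have hml : lm = q * lp := by rw [hq]; field_simp
  have hq1 : q ≤ 1 := by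
    by_contra hcon
    push Not at hcon
    have hq2 : 1 < q ^ 2 := one_lt_pow₀ hcon (by norm_num)
    obtain ⟨n, hn⟩ := pow_unbounded_of_one_lt (B2 / A1) hq2
    have hle := ev_cyl_minus_le_plus hβ0.le (rect (n + 1) H) (seg 1 (n + 1))
    rw [ev, ev, div_le_div_iff_of_pos_right (partition_pos _ _ _)] at hle
    have h3 := ((h1 (n + 1) (by omega)).1.trans hle).trans (h2 (n + 1) (by omega)).2
    set E := Real.exp (β * (((n + 1 : ℕ) : ℝ) - 1)) with hE
    have hE0 : 0 < E := Real.exp_pos _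
    have hl0 : 0 < (lp ^ 2) ^ (n + 1) := by positivity
    have h4 : A1 * (q ^ 2) ^ (n + 1) * (E * (lp ^ 2) ^ (n + 1)) ≤ B2 * (E * (lp ^ 2) ^ (n + 1)) := by
      refine le_trans (le_of_eq ?_) h3
      rw [hml, mul_pow, mul_pow (q ^ 2)]; ring
    have h5 := le_of_mul_le_mul_right h4 (mul_pos hE0 hl0)
    rw [div_lt_iff₀ hA1] at hn
    have : (q ^ 2) ^ n ≤ (q ^ 2) ^ (n + 1) := pow_le_pow_right₀ hq2.le (by omega)
    nlinarith
  have hqD : q ≤ 1 / D := by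
    rw [le_div_iff₀ (by linarith), mul_comm, ← le_div_iff₀ hq0]
    linarith
  refine ⟨B1 / A2, div_pos hB1 hA2, fun W hW => ?_⟩
  rw [ev, ev, ← mul_div_assoc, div_le_div_iff_of_pos_right (partition_pos _ _ _)]
  refine (h1 W hW).2.trans (le_trans ?_ (mul_le_mul_of_nonneg_left (h2 W hW).1 (by positivity)))
  have hqW : (q ^ 2) ^ W ≤ ((1 / D) ^ 2) ^ W :=
    pow_le_pow_left₀ (by positivity) (pow_le_pow_left₀ hq0.le hqD 2) W
  set E := Real.exp (β * ((W : ℝ) - 1)) with hE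
  have hE0 : 0 < E := Real.exp_pos _
  calc B1 * (E * (lm ^ 2) ^ W) = (q ^ 2) ^ W * (B1 * (E * (lp ^ 2) ^ W)) := by
        rw [hml, mul_pow, mul_pow (q ^ 2)]; ring
    _ ≤ ((1 / D) ^ 2) ^ W * (B1 * (E * (lp ^ 2) ^ W)) :=
        mul_le_mul_of_nonneg_right hqW (by positivity)
    _ = _ := by field_simp

end

end IsingLine

namespace IsingLine

open Finset hiding box

noncomputable section

variable {β : ℝ}

lemma cyl_congr {T : Finset (ℤ × ℤ)} {a ω ω' : Cfg2} (h : ∀ x ∈ T, ω x = ω' x) :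
    cyl T a ω = cyl T a ω' := by
  rw [cyl, cyl]
  exact if_congr (forall₂_congr fun x hx => by rw [h x hx]) rfl rfl

lemma cyl_self {T : Finset (ℤ × ℤ)} {a ω : Cfg2} (h : ∀ x ∈ T, ω x = a x) : cyl T a ω = 1 := by
  rw [cyl, if_pos h]

lemma ev_cyl_pos {Λ T : Finset (ℤ × ℤ)} {a σ : Cfg2} (h : ∀ x ∈ T, x ∉ Λ → a x = σ x) :
    0 < ev β Λ σ (cyl T a) := by
  classical
  refine ev_pos (fun ω _ => cyl_nonneg _ _ _) (ω := Λ.piecewise a σ) ?_ ?_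
  · rw [mem_cfgs]
    intro x hx
    simp [hx]
  · rw [cyl_self]
    · norm_num
    · intro x hx
      by_cases hL : x ∈ Λ
      · simp [hL]
      · simp [hL, h x hx hL]

lemma ev_cyl_le_one (Λ T : Finset (ℤ × ℤ)) (a σ : Cfg2) : ev β Λ σ (cyl T a) ≤ 1 :=
  (ev_mono fun ω _ => cyl_le_one T a ω).trans (ev_const (β := β) 1).le

lemma ev_log_le {Λ : Finset (ℤ × ℤ)} {σ : Cfg2} {f : Cfg2 → ℝ} (hf : ∀ ω, 0 < f ω) :
    ev β Λ σ (fun ω => Real.log (f ω)) ≤ Real.log (ev β Λ σ f) := by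
  set p := ev β Λ σ f with hp
  have hp0 : 0 < p := ev_pos (fun ω _ => (hf ω).le) (self_mem_cfgs Λ σ) (hf _)
  have h : ev β Λ σ (fun ω => Real.log (f ω)) ≤
      ev β Λ σ (fun ω => p⁻¹ * f ω + (Real.log p - 1)) := by
    refine ev_mono fun ω _ => ?_
    have h1 := Real.log_le_sub_one_of_pos (div_pos (hf ω) hp0)
    rw [Real.log_div (hf ω).ne' hp0.ne'] at h1
    rw [inv_mul_eq_div]
    linarith
  rw [ev_add, ev_const_mul, ev_const, ← hp, inv_mul_cancel₀ hp0.ne'] at h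
  linarith

lemma mul_log_le_ev {Λ : Finset (ℤ × ℤ)} {σ : Cfg2} {f : Cfg2 → ℝ} (hf : ∀ ω, 0 < f ω) :
    ev β Λ σ f * Real.log (ev β Λ σ f) ≤ ev β Λ σ (fun ω => f ω * Real.log (f ω)) := by
  set p := ev β Λ σ f with hp
  have hp0 : 0 < p := ev_pos (fun ω _ => (hf ω).le) (self_mem_cfgs Λ σ) (hf _)
  have h : ev β Λ σ (fun ω => (Real.log p + 1) * f ω + - p) ≤
      ev β Λ σ (fun ω => f ω * Real.log (f ω)) := by
    refine ev_mono fun ω _ => ?_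
    have h1 := Real.log_le_sub_one_of_pos (div_pos hp0 (hf ω))
    rw [Real.log_div hp0.ne' (hf ω).ne'] at h1
    have h2 := mul_le_mul_of_nonneg_left h1 (hf ω).le
    have h3 : f ω * (p / f ω - 1) = p - f ω := by field_simp [(hf ω).ne']
    rw [h3] at h2
    linarith
  rw [ev_add, ev_const_mul, ev_const, ← hp] at h
  linarith

/-- Comparison of the probabilities of an all-plus set in two volumes, up to the difference of
the boundary magnetizations around a set `Q`. -/
lemma log_cyl_plus_ge (hβ : 0 ≤ β) {T Q R U : Finset (ℤ × ℤ)} (hTQ : T ⊆ Q) (hQR : Q ⊆ R)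
    (hRU : R ⊆ U) :
    Real.log (ev β R plus (cyl T plus)) -
      2 * β * (ev β (R \ T) plus (bdry Q) - ev β U plus (bdry Q)) ≤
    Real.log (ev β U plus (cyl T plus)) := by
  set f : Cfg2 → ℝ := fun ω => ev β Q ω (cyl T plus) with hf
  have hf0 : ∀ ω, 0 < f ω := fun ω => ev_cyl_pos fun x hx hxQ => absurd (hTQ hx) hxQ
  have hpU : ev β U plus f = ev β U plus (cyl T plus) := ev_tower (hQR.trans hRU) _ _
  have hpR : ev β R plus f = ev β R plus (cyl T plus) := ev_tower hQR _ _
  have h1 := ev_log_le (β := β) (Λ := U) (σ := plus) hf0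
  rw [hpU] at h1
  have hG := log_ev_sub_bdry_antitone hβ Q (cyl T plus) (fun ω => cyl_nonneg _ _ _)
    (fun ω ω' h => cyl_congr fun x hx => h x (hTQ hx)) hf0
  have h2 := ev_plus_mono hβ (sdiff_subset.trans hRU : R \ T ⊆ U) hG
  rw [ev_sub, ev_sub, ev_const_mul, ev_const_mul] at h2
  change ev β (R \ T) plus (fun ω => Real.log (f ω)) - _ ≤
    ev β U plus (fun ω => Real.log (f ω)) - _ at h2
  have h3 := mul_log_le_ev (β := β) (Λ := R) (σ := plus) hf0
  have h4 : ev β R plus (fun ω => f ω * Real.log (f ω)) =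
      ev β R plus (cyl T plus) * ev β (R \ T) plus (fun ω => Real.log (f ω)) := by
    have h5 := ev_cyl_mul (β := β) (Λ := R) T plus plus (fun ω => Real.log (f ω))
    rw [piecewise_same] at h5
    rw [← h5, ← ev_tower hQR plus (fun ω => cyl T plus ω * Real.log (f ω))]
    refine ev_congr fun ω _ => ?_
    rw [mul_comm, hf, ← ev_const_mul]
    refine ev_congr fun η hη => ?_
    rw [mem_cfgs] at hη
    simp only
    rw [mul_comm, ev_congr_bc (σ := ω) (σ' := η) fun x hx => (hη x hx).symm]
  rw [h4, hpR] at h3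
  have hp0 : 0 < ev β R plus (cyl T plus) := ev_cyl_pos fun x _ _ => rfl
  have h6 := le_of_mul_le_mul_left h3 hp0
  linarith

lemma mem_box {n : ℕ} {x : ℤ × ℤ} :
    x ∈ box n ↔ (-(n : ℤ) ≤ x.1 ∧ x.1 ≤ n) ∧ -(n : ℤ) ≤ x.2 ∧ x.2 ≤ n := by
  simp [box]

lemma box_mono {m n : ℕ} (h : m ≤ n) : box m ⊆ box n := fun x hx => by
  rw [mem_box] at *
  omega

lemma exists_subset_box (Λ : Finset (ℤ × ℤ)) : ∃ n, Λ ⊆ box n := by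
  refine ⟨∑ x ∈ Λ, (x.1.natAbs + x.2.natAbs), fun x hx => ?_⟩
  have := single_le_sum (f := fun x : ℤ × ℤ => x.1.natAbs + x.2.natAbs) (fun _ _ => Nat.zero_le _) hx
  rw [mem_box]
  omega

/-- The spontaneous magnetization. -/
def mag (β : ℝ) : ℝ := ⨅ n : ℕ, ev β (box n) plus (fun ω => sval (ω 0))

lemma abs_ev_spin_le (Λ : Finset (ℤ × ℤ)) (σ : Cfg2) (y : ℤ × ℤ) :
    |ev β Λ σ (fun ω => sval (ω y))| ≤ 1 := by
  rw [abs_le]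
  constructor
  · refine (ev_const (β := β) (Λ := Λ) (σ := σ) (-1)).symm.le.trans (ev_mono fun ω _ => ?_)
    exact (abs_le.1 (abs_sval (ω y)).le).1
  · refine (ev_mono fun ω _ => ?_).trans (ev_const (β := β) (Λ := Λ) (σ := σ) 1).le
    exact (abs_le.1 (abs_sval (ω y)).le).2

lemma spin_mono (y : ℤ × ℤ) : Monotone fun ω : Cfg2 => sval (ω y) := fun _ _ h => sval_mono (h y)

lemma ev_spin_shift (Λ : Finset (ℤ × ℤ)) (y : ℤ × ℤ) : ev β Λ plus (fun ω => sval (ω y)) =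
    ev β (Λ.image (· - y)) plus (fun ω => sval (ω 0)) := by
  rw [ev_sh_plus]
  simp [sh]

lemma bddBelow_mag (β : ℝ) :
    BddBelow (Set.range fun n : ℕ => ev β (box n) plus (fun ω => sval (ω 0))) :=
  ⟨-1, by rintro _ ⟨n, rfl⟩; exact (abs_le.1 (abs_ev_spin_le _ _ _)).1⟩

lemma mag_le (hβ : 0 ≤ β) (Λ : Finset (ℤ × ℤ)) (y : ℤ × ℤ) :
    mag β ≤ ev β Λ plus (fun ω => sval (ω y)) := by
  obtain ⟨n, hn⟩ := exists_subset_box (Λ.image (· - y))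
  rw [ev_spin_shift]
  exact (ciInf_le (bddBelow_mag β) n).trans (ev_plus_antitone hβ hn (spin_mono 0))

lemma exists_box_le_mag (hβ : 0 ≤ β) {ε : ℝ} (hε : 0 < ε) (m : ℕ) : ∃ n : ℕ, m ≤ n ∧
    ev β (box n) plus (fun ω => sval (ω 0)) ≤ mag β + ε := by
  obtain ⟨n, hn⟩ := exists_lt_of_ciInf_lt
    (show (⨅ n : ℕ, ev β (box n) plus (fun ω => sval (ω 0))) < mag β + ε by
      rw [mag]; linarith)
  exact ⟨max m n, le_max_left _ _,
    (ev_plus_antitone hβ (box_mono (le_max_right m n)) (spin_mono 0)).trans hn.le⟩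

lemma ev_spin_le_box (hβ : 0 ≤ β) {Λ : Finset (ℤ × ℤ)} {y : ℤ × ℤ} {n : ℕ}
    (h : ∀ z ∈ box n, z + y ∈ Λ) :
    ev β Λ plus (fun ω => sval (ω y)) ≤ ev β (box n) plus (fun ω => sval (ω 0)) := by
  rw [ev_spin_shift]
  refine ev_plus_antitone hβ (fun z hz => ?_) (spin_mono 0)
  rw [mem_image]
  exact ⟨z + y, h z hz, by simp⟩

lemma mem_nbrs {x y : ℤ × ℤ} : y ∈ nbrs x ↔ (y.1 = x.1 + 1 ∧ y.2 = x.2) ∨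
    (y.1 = x.1 - 1 ∧ y.2 = x.2) ∨ (y.1 = x.1 ∧ y.2 = x.2 + 1) ∨ (y.1 = x.1 ∧ y.2 = x.2 - 1) := by
  simp [nbrs, Prod.ext_iff]

lemma bdry_diff_le (hβ : 0 ≤ β) {ε : ℝ} (hε : 0 < ε) {l : ℕ} (hl : 1 ≤ l)
    (hle : ev β (box l) plus (fun ω => sval (ω 0)) ≤ mag β + ε) (W : ℕ) (U : Finset (ℤ × ℤ)) :
    ev β (rect W (2 * l + 1) \ seg 1 W) plus (bdry (rect W l)) - ev β U plus (bdry (rect W l)) ≤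
      2 * ε * W + 16 * l * (2 * l + 1) := by
  set R' := rect W (2 * l + 1) \ seg 1 W with hR'
  set d : ℤ × ℤ → ℝ := fun y => ev β R' plus (fun ω => sval (ω y)) -
    ev β U plus (fun ω => sval (ω y)) with hd
  have hd2 : ∀ y, d y ≤ 2 := fun y => by
    have h1 := (abs_le.1 (abs_ev_spin_le (β := β) R' plus y)).2
    have h2 := (abs_le.1 (abs_ev_spin_le (β := β) U plus y)).1
    simp only [hd]; linarith
  have hdg : ∀ y : ℤ × ℤ, (l : ℤ) + 1 ≤ y.1 → y.1 ≤ (W : ℤ) - l →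
      (y.2 = l + 1 ∨ y.2 = -(l : ℤ) - 1) → d y ≤ ε := fun y h1 h2 h3 => by
    have h4 := mag_le hβ U y
    have h5 := (ev_spin_le_box hβ (Λ := R') (y := y) (n := l) fun z hz => by
      rw [mem_box] at hz
      rw [hR', Finset.mem_sdiff, mem_rect, mem_seg]
      simp only [Prod.fst_add, Prod.snd_add]
      push_cast
      omega).trans hle
    simp only [hd]; linarith
  have hexp : ∀ Λ : Finset (ℤ × ℤ), ev β Λ plus (bdry (rect W l)) = ∑ x ∈ rect W l,
      ∑ y ∈ (nbrs x).filter (fun y => y ∉ rect W l), ev β Λ plus (fun ω => sval (ω y)) := by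
    intro Λ
    unfold bdry
    rw [ev_sum]
    exact sum_congr rfl fun x _ => ev_sum _ _
  rw [hexp, hexp, ← sum_sub_distrib]
  simp only [← sum_sub_distrib]
  have hin : ∀ x ∈ rect W l, ∑ y ∈ (nbrs x).filter (fun y => y ∉ rect W l), d y ≤
      ((if x.2 = l then ε else 0) + (if x.2 = -(l : ℤ) then ε else 0)) +
        if x.1 ≤ l ∨ (W : ℤ) - l < x.1 then 8 else 0 := by
    intro x hx
    rw [mem_rect] at hx
    by_cases hbad : x.1 ≤ l ∨ (W : ℤ) - l < x.1
    · rw [if_pos hbad]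
      have h8 : ∑ y ∈ (nbrs x).filter (fun y => y ∉ rect W l), d y ≤ 8 := by
        refine (sum_le_card_nsmul _ _ 2 fun y _ => hd2 y).trans ?_
        have h4 : ((nbrs x).filter (fun y => y ∉ rect W l)).card ≤ 4 :=
          (card_filter_le _ _).trans card_le_four
        have : (((nbrs x).filter (fun y => y ∉ rect W l)).card : ℝ) ≤ 4 := by exact_mod_cast h4
        rw [nsmul_eq_mul]; linarith
      have : 0 ≤ (if x.2 = (l : ℤ) then ε else 0) + (if x.2 = -(l : ℤ) then ε else 0) := by
        split_ifs <;> linarith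
      linarith
    · rw [if_neg hbad, add_zero]
      have hc : ∀ y ∈ (nbrs x).filter (fun y => y ∉ rect W l), d y ≤ ε := fun y hy => by
        rw [mem_filter, mem_nbrs, mem_rect] at hy
        exact hdg y (by omega) (by omega) (by omega)
      have hcard : ((nbrs x).filter (fun y => y ∉ rect W l)).card ≤
          (if x.2 = l then 1 else 0) + (if x.2 = -(l : ℤ) then 1 else 0) := by
        by_cases h1 : x.2 = l
        · rw [if_pos h1]
          refine (card_le_one.2 fun y hy z hz => ?_).trans (Nat.le_add_right _ _)
          rw [mem_filter, mem_nbrs, mem_rect] at hy hz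
          ext <;> omega
        by_cases h2 : x.2 = -(l : ℤ)
        · rw [if_neg h1, if_pos h2, zero_add]
          refine card_le_one.2 fun y hy z hz => ?_
          rw [mem_filter, mem_nbrs, mem_rect] at hy hz
          ext <;> omega
        · rw [if_neg h1, if_neg h2, Nat.le_zero, card_eq_zero, filter_eq_empty_iff]
          intro y hy
          rw [mem_nbrs] at hy
          rw [mem_rect, not_not]
          omega
      refine (sum_le_card_nsmul _ _ ε hc).trans ?_
      rw [nsmul_eq_mul]
      refine (mul_le_mul_of_nonneg_right (Nat.cast_le.2 hcard) hε.le).trans (le_of_eq ?_)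
      push_cast
      rw [add_mul, ite_mul, ite_mul, one_mul, zero_mul]
  refine (sum_le_sum hin).trans ?_
  have hprod : ∑ x ∈ rect W l,
      (((if x.2 = (l : ℤ) then ε else 0) + (if x.2 = -(l : ℤ) then ε else 0)) +
        if x.1 ≤ l ∨ (W : ℤ) - l < x.1 then 8 else 0) =
      ∑ a ∈ Icc 1 (W : ℤ), ∑ b ∈ Icc (-(l : ℤ)) l,
      (((if b = (l : ℤ) then ε else 0) + (if b = -(l : ℤ) then ε else 0)) +
        if a ≤ l ∨ (W : ℤ) - l < a then 8 else 0) := by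
    rw [rect, sum_product]
  rw [hprod]
  simp only [sum_add_distrib, sum_ite_eq', sum_const]
  have hl1 : (l : ℤ) ∈ Icc (-(l : ℤ)) l := by rw [mem_Icc]; omega
  have hl2 : -(l : ℤ) ∈ Icc (-(l : ℤ)) l := by rw [mem_Icc]; omega
  rw [if_pos hl1, if_pos hl2]
  simp only [Int.card_Icc, nsmul_eq_mul]
  rw [← mul_sum, ← sum_filter, sum_const, nsmul_eq_mul]
  have hcard : ((Icc (1 : ℤ) W).filter fun a : ℤ => a ≤ (l : ℤ) ∨ (W : ℤ) - l < a).card ≤ 2 * l := by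
    refine (card_le_card (t := Icc 1 (l : ℤ) ∪ Icc ((W : ℤ) - l + 1) W) fun a ha => ?_).trans
      ((card_union_le _ _).trans ?_)
    · rw [mem_filter, mem_Icc] at ha
      rw [mem_union, mem_Icc, mem_Icc]
      omega
    · rw [Int.card_Icc, Int.card_Icc]; omega
  have e1 : ((W : ℤ) + 1 - 1).toNat = W := by omega
  have e2 : ((l : ℤ) + 1 - -(l : ℤ)).toNat = 2 * l + 1 := by omega
  rw [e1, e2]
  have hcr : (((Icc (1 : ℤ) W).filter fun a : ℤ => a ≤ (l : ℤ) ∨ (W : ℤ) - l < a).card : ℝ) ≤ 2 * l := by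
    exact_mod_cast hcard
  have := mul_le_mul_of_nonneg_left hcr (show (0 : ℝ) ≤ ((2 * l + 1 : ℕ) : ℝ) * 8 by positivity)
  push_cast at this ⊢
  linarith

/-- For large rectangles, the probability of a plus row is at most that in any larger volume, up
to an exponential factor of arbitrarily small rate. -/
theorem exists_row_plus_compare (hβ : 0 ≤ β) {δ : ℝ} (hδ : 1 < δ) (m : ℕ) : ∃ H : ℕ, ∃ C : ℝ, m ≤ H ∧
    0 < C ∧ ∀ (W : ℕ) (U : Finset (ℤ × ℤ)), rect W H ⊆ U →
      ev β (rect W H) plus (cyl (seg 1 W) plus) ≤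
        C * δ ^ W * ev β U plus (cyl (seg 1 W) plus) := by
  have hlog : 0 < Real.log δ := Real.log_pos hδ
  set ε := Real.log δ / (4 * β + 1) with hε
  have hb : 0 < 4 * β + 1 := by linarith
  have hε0 : 0 < ε := div_pos hlog hb
  have hεb : 4 * β * ε ≤ Real.log δ := by
    rw [hε, ← mul_div_assoc, div_le_iff₀ hb]
    nlinarith
  obtain ⟨l, hl, hle⟩ := exists_box_le_mag hβ hε0 (m + 1)
  refine ⟨2 * l + 1, Real.exp (2 * β * (16 * l * (2 * l + 1))), by omega, Real.exp_pos _,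
    fun W U hU => ?_⟩
  have h1 := log_cyl_plus_ge hβ (T := seg 1 W) (Q := rect W l) (R := rect W (2 * l + 1)) (U := U)
    (seg_subset_rect W l) (fun x hx => by rw [mem_rect] at *; push_cast; omega) hU
  have h2 := mul_le_mul_of_nonneg_left (bdry_diff_le hβ hε0 (by omega) hle W U)
    (show 0 ≤ 2 * β by linarith)
  have h3 := mul_le_mul_of_nonneg_right hεb (Nat.cast_nonneg (α := ℝ) W)
  have hp1 : 0 < ev β (rect W (2 * l + 1)) plus (cyl (seg 1 W) plus) := ev_cyl_pos fun _ _ _ => rfl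
  have hp2 : 0 < ev β U plus (cyl (seg 1 W) plus) := ev_cyl_pos fun _ _ _ => rfl
  have hδ0 : 0 < δ := by linarith
  have hδW : 0 < δ ^ W := pow_pos hδ0 W
  generalize ev β (rect W (2 * l + 1)) plus (cyl (seg 1 W) plus) = p at *
  generalize ev β U plus (cyl (seg 1 W) plus) = p' at *
  have hC : 0 < Real.exp (2 * β * (16 * l * (2 * l + 1))) := Real.exp_pos _
  rw [← Real.log_le_log_iff hp1 (mul_pos (mul_pos hC hδW) hp2),
    Real.log_mul (mul_pos hC hδW).ne' hp2.ne', Real.log_mul hC.ne' hδW.ne', Real.log_exp,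
    Real.log_pow]
  linarith

end

end IsingLine

namespace IsingLine

open Finset hiding box

noncomputable section

variable {β : ℝ} {μ : Measure Cfg2} {σ : Cfg2}

/-- The probability that the configuration agrees with `a` on `T`. -/
def prob (μ : Measure Cfg2) (T : Finset (ℤ × ℤ)) (a : Cfg2) : ℝ := μ.real {η | ∀ i ∈ T, η i = a i}

lemma measurableSet_agree {ι : Type*} (T : Finset ι) (a : ι → Bool) :
    MeasurableSet {η : ι → Bool | ∀ i ∈ T, η i = a i} := by
  have : {η : ι → Bool | ∀ i ∈ T, η i = a i} = ⋂ i ∈ T, (fun η : ι → Bool => η i) ⁻¹' {a i} := by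
    ext; simp
  rw [this]
  exact T.measurableSet_biInter fun i _ => measurable_pi_apply i (measurableSet_singleton _)

lemma tendsto_ev_cyl [IsFiniteMeasure μ] (h : CylTendsto (fun n => isingFV β 0 (box n) σ) μ)
    (T : Finset (ℤ × ℤ)) (a : Cfg2) :
    Tendsto (fun n => ev β (box n) σ (cyl T a)) atTop (𝓝 (prob μ T a)) := by
  have h1 := (ENNReal.tendsto_toReal (measure_ne_top μ _)).comp (h T a)
  refine h1.congr fun n => ?_
  simp only [Function.comp]
  rw [isingFV_apply (measurableSet_agree T a), ENNReal.toReal_ofReal]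
  · congr 1
    funext ω
    simp only [Set.indicator, cyl, Set.mem_ofPred_eq, Pi.one_apply]
  · exact ev_nonneg fun ω _ => Set.indicator_nonneg (fun _ _ => zero_le_one) _

lemma eventually_subset_box (Λ : Finset (ℤ × ℤ)) : ∀ᶠ n in atTop, Λ ⊆ box n := by
  obtain ⟨m, hm⟩ := exists_subset_box Λ
  exact eventually_atTop.2 ⟨m, fun n hn => hm.trans (box_mono hn)⟩

lemma cyl_mul_minus (T T' : Finset (ℤ × ℤ)) (ω : Cfg2) :
    cyl T (fun _ => false) ω * cyl T' (fun _ => false) ω = cyl (T ∪ T') (fun _ => false) ω := by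
  classical
  rw [cyl, cyl, cyl, ite_zero_mul_ite_zero, mul_one]
  refine if_congr ?_ rfl rfl
  simp only [mem_union, or_imp, forall_and]

lemma ev_union_minus_ge (hβ : 0 ≤ β) (Λ T T' : Finset (ℤ × ℤ)) (σ : Cfg2) :
    ev β Λ σ (cyl T fun _ => false) * ev β Λ σ (cyl T' fun _ => false) ≤
      ev β Λ σ (cyl (T ∪ T') fun _ => false) := by
  refine (ev_minus_mul_ge hβ T (cyl_minus_anti T')).trans (le_of_eq ?_)
  exact ev_congr fun ω _ => cyl_mul_minus _ _ _

lemma seg_add (a : ℤ) (j k : ℕ) : seg a (j + k) = seg a j ∪ seg (a + j) k := by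
  ext x
  rw [mem_union, mem_seg, mem_seg, mem_seg]
  push_cast
  omega

lemma ev_seg_add_ge (hβ : 0 ≤ β) (Λ : Finset (ℤ × ℤ)) (a : ℤ) (j k : ℕ) :
    ev β Λ plus (cyl (seg a j) fun _ => false) * ev β Λ plus (cyl (seg (a + j) k) fun _ => false) ≤
      ev β Λ plus (cyl (seg a (j + k)) fun _ => false) := by
  rw [seg_add]
  exact ev_union_minus_ge hβ _ _ _ _

lemma ev_seg_nonneg (Λ : Finset (ℤ × ℤ)) (a : ℤ) (k : ℕ) (b : Cfg2) :
    0 ≤ ev β Λ plus (cyl (seg a k) b) := ev_nonneg fun _ _ => cyl_nonneg _ _ _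

lemma pow_le_ev_seg (hβ : 0 ≤ β) {P : ℝ} (hP : 0 ≤ P) {Λ : Finset (ℤ × ℤ)} {a : ℤ} {n : ℕ} :
    ∀ k : ℕ, (∀ i < k, P ≤ ev β Λ plus (cyl (seg (a + (i * n : ℕ)) n) fun _ => false)) →
      P ^ k ≤ ev β Λ plus (cyl (seg a (k * n)) fun _ => false)
  | 0, _ => by
    have : cyl (seg a (0 * n)) (fun _ => false) = fun _ => 1 := by
      funext ω
      refine cyl_self fun x hx => ?_
      rw [mem_seg] at hx
      simp only [Nat.zero_mul, Nat.cast_zero] at hx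
      omega
    rw [this, ev_const, pow_zero]
  | k + 1, h => by
    have ih := pow_le_ev_seg hβ hP k fun i hi => h i (by omega)
    rw [pow_succ, Nat.succ_mul]
    exact (mul_le_mul ih (h k (by omega)) hP (ev_seg_nonneg _ _ _ _)).trans
      (ev_seg_add_ge hβ _ _ _ _)

lemma cyl_seg_sh (a b : ℤ) (k : ℕ) (ω : Cfg2) : cyl (seg a k) (fun _ => false) (sh (b, 0) ω) =
    cyl (seg (a + b) k) (fun _ => false) ω := by
  rw [cyl, cyl]
  refine if_congr ⟨fun h x hx => ?_, fun h x hx => ?_⟩ rfl rfl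
  · have := h (x - (b, 0)) (by
      rw [mem_seg] at *
      simp only [Prod.fst_sub, Prod.snd_sub]
      omega)
    simpa [sh] using this
  · refine h (x + (b, 0)) ?_
    rw [mem_seg] at *
    simp only [Prod.fst_add, Prod.snd_add]
    omega

lemma ev_seg_shift_le (hβ : 0 ≤ β) {Δ Λ : Finset (ℤ × ℤ)} {b : ℤ} (h : ∀ z ∈ Δ, z + (b, 0) ∈ Λ)
    (a : ℤ) (n : ℕ) : ev β Δ plus (cyl (seg a n) fun _ => false) ≤
      ev β Λ plus (cyl (seg (a + b) n) fun _ => false) := by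
  have h1 : ev β Λ plus (cyl (seg (a + b) n) fun _ => false) =
      ev β (Λ.image (· - (b, 0))) plus (cyl (seg a n) fun _ => false) := by
    rw [ev_sh_plus]
    simp only [cyl_seg_sh]
  rw [h1]
  refine ev_plus_mono hβ (fun z hz => ?_) (cyl_minus_anti _)
  rw [mem_image]
  exact ⟨_, h z hz, by simp⟩

section Limit

variable [IsFiniteMeasure μ] (hμ : CylTendsto (fun n => isingFV β 0 (box n) fun _ => true) μ)
include hμ

lemma ev_le_prob_minus (hβ : 0 ≤ β) (Λ : Finset (ℤ × ℤ)) (a : ℤ) (n : ℕ) (b : ℤ) :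
    ev β Λ plus (cyl (seg a n) fun _ => false) ≤ prob μ (seg b n) fun _ => false := by
  refine ge_of_tendsto (tendsto_ev_cyl hμ _ _) ?_
  filter_upwards [eventually_subset_box (Λ.image (· + (b - a, 0)))] with N hN
  have := ev_seg_shift_le hβ (Δ := Λ) (Λ := box N) (b := b - a)
    (fun z hz => hN (mem_image_of_mem _ hz)) a n
  rwa [add_sub_cancel] at this

lemma prob_minus_shift (hβ : 0 ≤ β) (a b : ℤ) (n : ℕ) :
    prob μ (seg a n) (fun _ => false) = prob μ (seg b n) fun _ => false :=
  le_antisymm (le_of_tendsto' (tendsto_ev_cyl hμ _ _) fun _ => ev_le_prob_minus hμ hβ _ _ _ _)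
    (le_of_tendsto' (tendsto_ev_cyl hμ _ _) fun _ => ev_le_prob_minus hμ hβ _ _ _ _)

/-- A minus spin is most likely after an all-minus block. -/
lemma prob_snoc_mul_le (hβ : 0 ≤ β) (a : ℤ) (k : ℕ) (f : Cfg2) (hf : f (a + k, 0) = false) :
    prob μ (seg a (k + 1)) f * prob μ (seg a k) (fun _ => false) ≤
      prob μ (seg a k) f * prob μ (seg a (k + 1)) fun _ => false := by
  classical
  refine le_of_tendsto_of_tendsto' ((tendsto_ev_cyl hμ _ _).mul (tendsto_ev_cyl hμ _ _))
    ((tendsto_ev_cyl hμ _ _).mul (tendsto_ev_cyl hμ _ _)) fun n => ?_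
  have hsp : ∀ g : Cfg2, g (a + k, 0) = false → ev β (box n) plus (cyl (seg a (k + 1)) g) =
      ev β (box n) plus (cyl (seg a k) g) * ev β (box n \ seg a k) ((seg a k).piecewise g plus)
        (cyl {(a + k, 0)} fun _ => false) := by
    intro g hg
    rw [← ev_cyl_mul]
    refine ev_congr fun ω _ => ?_
    rw [cyl, cyl, cyl, ite_zero_mul_ite_zero, mul_one]
    refine if_congr ⟨fun h => ⟨fun x hx => ?_, fun x hx => ?_⟩, fun h x hx => ?_⟩ rfl rfl
    · refine h x ?_
      rw [mem_seg] at *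
      push_cast
      omega
    · rw [mem_singleton] at hx
      rw [hx, h _ (by rw [mem_seg]; simp), hg]
    · by_cases hxs : x ∈ seg a k
      · exact h.1 x hxs
      · have : x = (a + k, 0) := by
          rw [mem_seg] at hx hxs
          push_cast at hx
          ext <;> simp only <;> omega
        rw [this, h.2 _ (mem_singleton_self _), hg]
  change ev β (box n) plus (cyl (seg a (k + 1)) f) *
      ev β (box n) plus (cyl (seg a k) fun _ => false) ≤
    ev β (box n) plus (cyl (seg a k) f) *
      ev β (box n) plus (cyl (seg a (k + 1)) fun _ => false)
  rw [hsp f hf, hsp (fun _ => false) rfl, mul_assoc]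
  refine mul_le_mul_of_nonneg_left ?_ (ev_seg_nonneg _ _ _ _)
  rw [mul_comm]
  refine mul_le_mul_of_nonneg_left ?_ (ev_seg_nonneg _ _ _ _)
  refine ev_anti hβ ?_ (cyl_minus_anti _)
  intro x
  by_cases hx : x ∈ seg a k <;> simp [hx]

lemma prob_minus_pos (hβ : 0 ≤ β) (a : ℤ) (k : ℕ) : 0 < prob μ (seg a k) fun _ => false :=
  lt_of_lt_of_le (ev_cyl_pos fun _ hx hx' => absurd hx hx')
    (ev_le_prob_minus hμ hβ (seg a k) a k a)

lemma prob_minus_log_convex (hβ : 0 ≤ β) (k : ℕ) :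
    prob μ (seg 0 (k + 1)) (fun _ => false) ^ 2 ≤
      prob μ (seg 0 k) (fun _ => false) * prob μ (seg 0 (k + 2)) fun _ => false := by
  classical
  rw [sq]
  nth_rewrite 2 [prob_minus_shift hμ hβ 0 1]
  rw [prob_minus_shift hμ hβ 0 1 k]
  refine le_of_tendsto_of_tendsto' ((tendsto_ev_cyl hμ _ _).mul (tendsto_ev_cyl hμ _ _))
    ((tendsto_ev_cyl hμ _ _).mul (tendsto_ev_cyl hμ _ _)) fun n => ?_
  set T := seg 1 k with hT
  set bc : Cfg2 := T.piecewise (fun _ => false) plus with hbc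
  have hsp : ∀ X : Finset (ℤ × ℤ), ev β (box n) plus (cyl (T ∪ X) fun _ => false) =
      ev β (box n) plus (cyl T fun _ => false) * ev β (box n \ T) bc (cyl X fun _ => false) := by
    intro X
    rw [← ev_cyl_mul]
    exact ev_congr fun ω _ => (cyl_mul_minus _ _ _).symm
  have e1 : seg 0 (k + 1) = T ∪ {(0, 0)} := by
    ext x
    rw [mem_union, mem_seg, mem_seg, mem_singleton, Prod.ext_iff]
    push_cast
    omega
  have e2 : seg 1 (k + 1) = T ∪ {((k : ℤ) + 1, 0)} := by
    ext x
    rw [mem_union, mem_seg, mem_seg, mem_singleton, Prod.ext_iff]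
    push_cast
    omega
  have e3 : seg 0 (k + 2) = T ∪ ({(0, 0)} ∪ {((k : ℤ) + 1, 0)}) := by
    ext x
    rw [mem_union, mem_union, mem_seg, mem_seg, mem_singleton, mem_singleton, Prod.ext_iff,
      Prod.ext_iff]
    push_cast
    omega
  change ev β (box n) plus (cyl (seg 0 (k + 1)) fun _ => false) *
      ev β (box n) plus (cyl (seg 1 (k + 1)) fun _ => false) ≤
    ev β (box n) plus (cyl T fun _ => false) *
      ev β (box n) plus (cyl (seg 0 (k + 2)) fun _ => false)
  rw [e1, e2, e3, hsp, hsp, hsp]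
  have h := ev_union_minus_ge hβ (box n \ T) {(0, 0)} {((k : ℤ) + 1, 0)} bc
  have h0 : 0 ≤ ev β (box n) plus (cyl T fun _ => false) := ev_seg_nonneg _ _ _ _
  have := mul_le_mul_of_nonneg_left h (mul_nonneg h0 h0)
  linarith

/-- An exponential bound on the probabilities of minus blocks bounds their ratios. -/
lemma prob_minus_succ_le (hβ : 0 ≤ β) {s : ℝ} (hs : 0 < s)
    (h : ∀ n, prob μ (seg 0 n) (fun _ => false) ≤ s ^ n) (k : ℕ) :
    prob μ (seg 0 (k + 1)) (fun _ => false) ≤ s * prob μ (seg 0 k) fun _ => false := by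
  set p : ℕ → ℝ := fun n => prob μ (seg 0 n) fun _ => false with hp
  have hp0 : ∀ n, 0 < p n := prob_minus_pos hμ hβ 0
  have hlc : ∀ n, p (n + 1) ^ 2 ≤ p n * p (n + 2) := prob_minus_log_convex hμ hβ
  by_contra hcon
  push Not at hcon
  change s * p k < p (k + 1) at hcon
  set t := p (k + 1) / p k with ht
  have hst : s < t := by rw [ht, lt_div_iff₀ (hp0 k)]; exact hcon
  have ht0 : 0 < t := hs.trans hst
  have hr : ∀ m, t * p (k + m) ≤ p (k + m + 1) := by
    intro m
    induction m with
    | zero => rw [ht, add_zero, div_mul_cancel₀ _ (hp0 k).ne']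
    | succ m ih =>
      have h1 := hlc (k + m)
      have h2 := mul_le_mul_of_nonneg_right ih (hp0 (k + m + 2)).le
      rw [← add_assoc]
      have h3 : p (k + m) * (t * p (k + m + 1)) ≤ p (k + m) * p (k + m + 2) := by
        nlinarith [hp0 (k + m + 1)]
      exact le_of_mul_le_mul_left h3 (hp0 _)
  have hg : ∀ m, p k * t ^ m ≤ p (k + m) := by
    intro m
    induction m with
    | zero => simp
    | succ m ih =>
      rw [pow_succ', ← add_assoc]
      have := mul_le_mul_of_nonneg_left ih ht0.le
      linarith [hr m]
  obtain ⟨m, hm⟩ := pow_unbounded_of_one_lt (s ^ k / p k) ((one_lt_div hs).2 hst)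
  have h1 := (hg m).trans (h (k + m))
  rw [div_pow, div_lt_div_iff₀ (hp0 k) (pow_pos hs m), ← pow_add] at hm
  linarith

lemma half_le_prob_plus (hβ : 0 ≤ β) (a : ℤ) : 1 / 2 ≤ prob μ (seg a 1) plus := by
  refine ge_of_tendsto' (tendsto_ev_cyl hμ _ _) fun n => ?_
  have h1 := ev_cyl_minus_le_plus hβ (box n) (seg a 1)
  have h2 : ev β (box n) plus (fun ω => cyl (seg a 1) (fun _ => false) ω + cyl (seg a 1) plus ω) =
      1 := by
    rw [← ev_const (β := β) (Λ := box n) (σ := plus) 1]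
    refine ev_congr fun ω _ => ?_
    have hs : ∀ x, x ∈ seg a 1 ↔ x = (a, 0) := fun x => by
      rw [mem_seg, Prod.ext_iff]
      push_cast
      omega
    simp only [cyl, hs, forall_eq]
    cases ω (a, 0) <;> simp
  rw [ev_add] at h2
  change 1 / 2 ≤ ev β (box n) plus (cyl (seg a 1) plus)
  linarith

end Limit

end

end IsingLine

namespace IsingLine

open Finset hiding box

noncomputable section

variable {β : ℝ} {μ : Measure Cfg2}

lemma exists_sInf_rate {q : ℕ → ℝ} {c : ℝ} (hc : 0 < c) (hq1 : c ≤ q 1) (hq : ∀ W, q W ≤ 1) :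
    ∃ r : ℝ, 0 < r ∧ r ≤ 1 ∧ (∀ W, 1 ≤ W → q W ≤ r ^ W) ∧
      ∀ t, 0 ≤ t → t < r → ∃ W, t ^ W < q W := by
  set S : Set ℝ := {t | 0 ≤ t ∧ ∀ W, 1 ≤ W → q W ≤ t ^ W} with hS
  have h1 : (1 : ℝ) ∈ S := ⟨zero_le_one, fun W _ => by simpa using hq W⟩
  have hb : BddBelow S := ⟨0, fun t ht => ht.1⟩
  have hcl : IsClosed S := by
    have : S = Set.Ici 0 ∩ ⋂ W : ℕ, ⋂ _ : 1 ≤ W, {t | q W ≤ t ^ W} := by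
      ext t; simp [hS]
    rw [this]
    exact isClosed_Ici.inter (isClosed_iInter fun W => isClosed_iInter fun _ =>
      isClosed_le continuous_const (continuous_pow W))
  have hmem : sInf S ∈ S := hcl.csInf_mem ⟨1, h1⟩ hb
  refine ⟨sInf S, ?_, csInf_le hb h1, hmem.2, fun t ht0 ht => ?_⟩
  · have := hmem.2 1 le_rfl
    rw [pow_one] at this
    linarith
  · by_contra hcon
    push Not at hcon
    exact absurd (csInf_le hb (show t ∈ S from ⟨ht0, fun W _ => hcon W⟩)) (not_le.2 ht)

lemma le_of_pow_mul_le {P Q c C : ℝ} (hQ : 0 < Q) (hc : 0 < c)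
    (h : ∀ k : ℕ, P ^ k * c ≤ C * Q ^ k) : P ≤ Q := by
  by_contra hcon
  push Not at hcon
  obtain ⟨k, hk⟩ := pow_unbounded_of_one_lt (C / c) ((one_lt_div hQ).2 hcon)
  rw [div_pow, div_lt_div_iff₀ hc (pow_pos hQ k)] at hk
  linarith [h k]

/-- A bound on minus blocks in rectangles gives, by supermultiplicativity, a bound on minus
blocks in boxes. -/
lemma ev_box_minus_le (hβ0 : 0 ≤ β) {s K : ℝ} {H N n : ℕ} (hsp : 0 < s)
    (hH : N + 1 ≤ H)
    (hrect : ∀ W : ℕ, 1 ≤ W → ev β (rect W H) plus (cyl (seg 1 W) fun _ => false) ≤ K * s ^ W) :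
    ev β (box N) plus (cyl (seg 0 n) fun _ => false) ≤ s ^ n := by
  set P := ev β (box N) plus (cyl (seg 0 n) fun _ => false) with hP
  have hP0 : 0 ≤ P := ev_seg_nonneg _ _ _ _
  set c := ev β {(0, 0)} plus (cyl (seg 0 1) fun _ => false) with hc
  have hc0 : 0 < c := by
    refine ev_cyl_pos fun x hx hx' => ?_
    rw [mem_seg] at hx
    rw [mem_singleton, Prod.ext_iff] at hx'
    push_cast at hx
    omega
  have hc' : ∀ (Λ : Finset (ℤ × ℤ)) (a : ℤ), (a, 0) ∈ Λ →
      c ≤ ev β Λ plus (cyl (seg a 1) fun _ => false) := by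
    intro Λ a ha
    have := ev_seg_shift_le hβ0 (Δ := {(0, 0)}) (Λ := Λ) (b := a) (fun z hz => by
      rw [mem_singleton] at hz
      simpa [hz] using ha) 0 1
    rwa [zero_add] at this
  refine le_of_pow_mul_le (C := K * s ^ (2 * N + 1)) (pow_pos hsp n)
    (pow_pos hc0 (2 * N + 1)) fun k => ?_
  set W := N + k * n + (N + 1) with hW
  have hend : ∀ (a : ℤ) (m : ℕ), 1 ≤ a → a + m ≤ W + 1 →
      c ^ m ≤ ev β (rect W H) plus (cyl (seg a m) fun _ => false) := by
    intro a m ha1 ha2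
    have := pow_le_ev_seg hβ0 hc0.le (Λ := rect W H) (a := a) (n := 1) m fun i hi => by
      refine hc' _ _ ?_
      rw [mem_rect]
      push_cast
      omega
    rwa [mul_one] at this
  have hmid : P ^ k ≤ ev β (rect W H) plus (cyl (seg (1 + N) (k * n)) fun _ => false) := by
    refine pow_le_ev_seg hβ0 hP0 k fun i hi => ?_
    have hin : i * n ≤ k * n := Nat.mul_le_mul_right n hi.le
    have := ev_seg_shift_le hβ0 (Δ := box N) (Λ := rect W H) (b := 1 + N + (i * n : ℕ))
      (fun z hz => by
        rw [mem_box] at hz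
        rw [mem_rect]
        simp only [Prod.fst_add, Prod.snd_add]
        omega) 0 n
    rwa [zero_add] at this
  have h1 : c ^ N * P ^ k ≤ ev β (rect W H) plus (cyl (seg 1 (N + k * n)) fun _ => false) :=
    (mul_le_mul (hend 1 N le_rfl (by omega)) hmid (pow_nonneg hP0 k)
      (ev_seg_nonneg _ _ _ _)).trans (ev_seg_add_ge hβ0 _ _ _ _)
  have h2 : c ^ N * P ^ k * c ^ (N + 1) ≤ ev β (rect W H) plus (cyl (seg 1 W) fun _ => false) :=
    (mul_le_mul h1 (hend (1 + (N + k * n : ℕ)) (N + 1) (by omega) (by omega))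
      (pow_nonneg hc0.le _)
      (ev_seg_nonneg _ _ _ _)).trans (ev_seg_add_ge hβ0 _ _ _ _)
  have h3 := h2.trans (hrect W (by omega))
  have e : s ^ W = s ^ (2 * N + 1) * (s ^ n) ^ k := by
    rw [← pow_mul, ← pow_add]
    congr 1
    rw [hW]
    ring
  rw [e] at h3
  calc P ^ k * c ^ (2 * N + 1) = c ^ N * P ^ k * c ^ (N + 1) := by ring
    _ ≤ _ := h3
    _ = _ := by ring

/-- In a supercritical plus phase, minus blocks on the line are exponentially less likely than
plus blocks. -/
theorem exists_rate (hβ : betaCrit < β) [IsFiniteMeasure μ]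
    (hμ : CylTendsto (fun n => isingFV β 0 (box n) fun _ => true) μ) : ∃ s : ℝ, 0 < s ∧ s < 1 ∧
      (∀ n, prob μ (seg 0 n) (fun _ => false) ≤ s ^ n) ∧ ∃ n, s ^ n < prob μ (seg 1 n) plus := by
  have hβ0 : 0 ≤ β := (betaCrit_pos.trans hβ).le
  obtain ⟨θ, hθ0, hθ1, hθ⟩ := exists_row_cost hβ
  have hδ : 1 < 2 / (1 + θ) := by rw [lt_div_iff₀ (by linarith)]; linarith
  have hδθ : θ * (2 / (1 + θ)) < 1 := by
    rw [← mul_div_assoc, div_lt_one (by linarith)]; linarith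
  set δ := 2 / (1 + θ) with hδd
  have hle1 : ∀ T a, prob μ T a ≤ 1 := fun T a =>
    le_of_tendsto' (tendsto_ev_cyl hμ T a) fun _ => ev_cyl_le_one _ _ _ _
  obtain ⟨r, hr0, hr1, hqr, hrq⟩ := exists_sInf_rate (q := fun W => prob μ (seg 1 W) plus)
    (c := 1 / 2) (by norm_num) (half_le_prob_plus hμ hβ0 1) (fun W => hle1 _ _)
  have hs0 : 0 < θ * δ := mul_pos hθ0 (by linarith)
  refine ⟨θ * δ * r, mul_pos hs0 hr0, by nlinarith, fun n => ?_, hrq _ (by positivity) (by nlinarith)⟩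
  set s := θ * δ * r with hs
  have hsp : 0 < s := mul_pos hs0 hr0
  refine le_of_tendsto' (tendsto_ev_cyl hμ _ _) fun N => ?_
  change ev β (box N) plus (cyl (seg 0 n) fun _ => false) ≤ s ^ n
  obtain ⟨H, C, hH, hC, hcmp⟩ := exists_row_plus_compare hβ0 hδ (N + 1)
  obtain ⟨C', hC', hrow⟩ := hθ H (by omega)
  have hrect : ∀ W : ℕ, 1 ≤ W →
      ev β (rect W H) plus (cyl (seg 1 W) fun _ => false) ≤ C' * C * s ^ W := by
    intro W hW
    have h1 : ev β (rect W H) plus (cyl (seg 1 W) plus) ≤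
        C * δ ^ W * prob μ (seg 1 W) plus := by
      refine ge_of_tendsto ((tendsto_ev_cyl hμ (seg 1 W) plus).const_mul (C * δ ^ W)) ?_
      filter_upwards [eventually_subset_box (rect W H)] with M hM
      exact hcmp W (box M) hM
    have hδW : 0 ≤ C * δ ^ W := by positivity
    have h2 := h1.trans (mul_le_mul_of_nonneg_left (hqr W hW) hδW)
    refine (hrow W hW).trans ((mul_le_mul_of_nonneg_left h2 (by positivity)).trans (le_of_eq ?_))
    rw [hs, mul_pow, mul_pow]
    ring
  exact ev_box_minus_le hβ0 hsp hH hrect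

end

end IsingLine

namespace IsingLine
open Finset hiding box
noncomputable section

/-- Extension by minus of a configuration on `T`. -/
def extMinus (T : Finset ℤ) (τ : T → Bool) : ZSeq Bool := fun i => if h : i ∈ T then τ ⟨i, h⟩ else false

lemma restrict_preimage_singleton (T : Finset ℤ) (τ : T → Bool) :
    (T.restrict : ZSeq Bool → T → Bool) ⁻¹' {τ} = {η | ∀ i ∈ T, η i = extMinus T τ i} := by
  ext η
  simp only [Set.mem_preimage, Set.mem_singleton_iff, funext_iff, Set.mem_ofPred_eq, Subtype.forall]
  refine forall₂_congr fun i hi => ?_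
  rw [extMinus, dif_pos hi]
  rfl

lemma exists_restrict_preimage {T : Finset ℤ} {D : Set (ZSeq Bool)}
    (hD : ∀ x y : ZSeq Bool, (∀ i ∈ T, x i = y i) → x ∈ D → y ∈ D) :
    ∃ S : Finset (T → Bool), D = T.restrict ⁻¹' (S : Set (T → Bool)) := by
  classical
  refine ⟨(Set.toFinite (T.restrict '' D)).toFinset, ?_⟩
  rw [Set.Finite.coe_toFinset]
  refine Set.Subset.antisymm (Set.subset_preimage_image _ _) fun y hy => ?_
  obtain ⟨x, hx, hxy⟩ := hy
  exact hD x y (fun i hi => congr_fun hxy ⟨i, hi⟩) hx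

lemma measurableSet_of_depends {T : Finset ℤ} {D : Set (ZSeq Bool)}
    (hD : ∀ x y : ZSeq Bool, (∀ i ∈ T, x i = y i) → x ∈ D → y ∈ D) : MeasurableSet D := by
  obtain ⟨S, rfl⟩ := exists_restrict_preimage hD
  exact T.measurable_restrict (Set.toFinite _).measurableSet

lemma measurableSet_minus (i : ℤ) : MeasurableSet {η : ZSeq Bool | η i = false} :=
  (measurable_pi_apply (X := fun _ => Bool) i) (measurableSet_singleton false)

lemma real_inter_eq_sum (ν : Measure (ZSeq Bool)) [IsFiniteMeasure ν] {T : Finset ℤ} {E : Set (ZSeq Bool)}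
    (hE : MeasurableSet E) (S : Finset (T → Bool)) :
    ν.real (T.restrict ⁻¹' (S : Set (T → Bool)) ∩ E) =
      ∑ τ ∈ S, ν.real ({η | ∀ i ∈ T, η i = extMinus T τ i} ∩ E) := by
  have := sum_measureReal_preimage_singleton (μ := ν.restrict E) S (f := T.restrict)
    fun τ _ => T.measurable_restrict (measurableSet_singleton τ)
  rw [measureReal_restrict_apply' hE] at this
  rw [← this]
  refine sum_congr rfl fun τ _ => ?_
  rw [measureReal_restrict_apply' hE, restrict_preimage_singleton]

lemma agree_inter_minus (a : ℤ) (k : ℕ) (τ : Ico a (a + k) → Bool) :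
    {η : ZSeq Bool | ∀ i ∈ Ico a (a + k), η i = extMinus _ τ i} ∩ {η | η (a + k) = false} =
      {η | ∀ i ∈ Ico a (a + (k + 1 : ℕ)), η i = extMinus _ τ i} := by
  have h0 : extMinus _ τ (a + k) = false := by
    rw [extMinus, dif_neg (by simp)]
  ext η
  simp only [Set.mem_inter_iff, Set.mem_ofPred_eq, mem_Ico]
  constructor
  · rintro ⟨h1, h2⟩ i hi
    push_cast at hi
    rcases eq_or_ne i (a + k) with rfl | hne
    · rw [h2, h0]
    · exact h1 i (by omega)
  · exact fun h => ⟨fun i hi => h i (by push_cast; omega), by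
      rw [h (a + k) (by push_cast; omega), h0]⟩

/-- A conditional bound for the last spin of a block given a pattern extends to local events. -/
lemma real_inter_minus_le {ν : Measure (ZSeq Bool)} [IsFiniteMeasure ν] {s : ℝ} {a : ℤ} {k : ℕ}
    (h : ∀ f : ℤ → Bool, f (a + k) = false →
      ν.real {η | ∀ i ∈ Ico a (a + (k + 1 : ℕ)), η i = f i} ≤
        s * ν.real {η | ∀ i ∈ Ico a (a + k), η i = f i}) {D : Set (ZSeq Bool)}
    (hD : ∀ x y : ZSeq Bool, (∀ i ∈ Ico a (a + k), x i = y i) → x ∈ D → y ∈ D) :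
    ν.real (D ∩ {η | η (a + k) = false}) ≤ s * ν.real D := by
  obtain ⟨S, rfl⟩ := exists_restrict_preimage hD
  have h2 := real_inter_eq_sum ν MeasurableSet.univ S
  simp only [Set.inter_univ] at h2
  rw [real_inter_eq_sum ν (measurableSet_minus _) S, h2, mul_sum]
  refine sum_le_sum fun τ _ => ?_
  rw [agree_inter_minus]
  exact h _ (by rw [extMinus, dif_neg (by simp)])

lemma real_inter_minus_eq {ν : Measure (ZSeq Bool)} [IsFiniteMeasure ν] {s : ℝ} {a : ℤ} {k : ℕ}
    (h : ∀ f : ℤ → Bool, f (a + k) = false →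
      ν.real {η | ∀ i ∈ Ico a (a + (k + 1 : ℕ)), η i = f i} =
        s * ν.real {η | ∀ i ∈ Ico a (a + k), η i = f i}) {D : Set (ZSeq Bool)}
    (hD : ∀ x y : ZSeq Bool, (∀ i ∈ Ico a (a + k), x i = y i) → x ∈ D → y ∈ D) :
    ν.real (D ∩ {η | η (a + k) = false}) = s * ν.real D := by
  obtain ⟨S, rfl⟩ := exists_restrict_preimage hD
  have h2 := real_inter_eq_sum ν MeasurableSet.univ S
  simp only [Set.inter_univ] at h2
  rw [real_inter_eq_sum ν (measurableSet_minus _) S, h2, mul_sum]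
  refine sum_congr rfl fun τ _ => ?_
  rw [agree_inter_minus]
  exact h _ (by rw [extMinus, dif_neg (by simp)])

/-- Windows exhausting the line. -/
def win (n : ℕ) : Finset ℤ := Ico (-(n : ℤ)) (-(n : ℤ) + (2 * n : ℕ))

lemma win_subset {m n : ℕ} (hmn : m ≤ n) : win m ⊆ win n := by
  intro i
  rw [win, win, mem_Ico, mem_Ico]
  push_cast
  omega

lemma mem_win (i : ℤ) : i ∈ win (i.natAbs + 1) := by
  rw [win, mem_Ico]
  omega

/-- Configurations dominating, on the window, some configuration of `K`. -/
def upWin (K : Set (ZSeq Bool)) (n : ℕ) : Set (ZSeq Bool) := {y | ∃ x ∈ K, ∀ i ∈ win n, x i ≤ y i}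

lemma upWin_increasing {K : Set (ZSeq Bool)} {n : ℕ} {x y : ZSeq Bool}
    (hxy : ∀ i ∈ win n, x i ≤ y i) (hx : x ∈ upWin K n) : y ∈ upWin K n := by
  obtain ⟨z, hz, hzx⟩ := hx
  exact ⟨z, hz, fun i hi => (hzx i hi).trans (hxy i hi)⟩

lemma upWin_antitone (K : Set (ZSeq Bool)) : Antitone (upWin K) := by
  rintro m n hmn y ⟨x, hx, hxy⟩
  exact ⟨x, hx, fun i hi => hxy i (win_subset hmn hi)⟩

lemma iInter_upWin_subset {K B : Set (ZSeq Bool)} (hK : IsCompact K) (hKB : K ⊆ B)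
    (hinc : ∀ ⦃x y : ZSeq Bool⦄, x ≤ y → x ∈ B → y ∈ B) : ⋂ n, upWin K n ⊆ B := by
  intro y hy
  have hcl : ∀ n, IsClosed {x : ZSeq Bool | ∀ i ∈ win n, x i ≤ y i} := by
    intro n
    simp only [Set.ofPred_forall]
    exact isClosed_biInter fun i _ => IsClosed.preimage (continuous_apply (A := fun _ => Bool) i)
      (isClosed_discrete {b : Bool | b ≤ y i})
  obtain ⟨x, hx⟩ := IsCompact.nonempty_iInter_of_sequence_nonempty_isCompact_isClosed
    (fun n : ℕ => K ∩ {x : ZSeq Bool | ∀ i ∈ win n, x i ≤ y i})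
    (fun n => Set.inter_subset_inter_right K fun x hx i hi =>
      hx i (win_subset (Nat.le_succ n) hi))
    (fun n => by
      obtain ⟨x, hx, hxy⟩ := Set.mem_iInter.1 hy n
      exact ⟨x, hx, hxy⟩)
    (hK.inter_right (hcl 0)) (fun n => hK.isClosed.inter (hcl n))
  rw [Set.mem_iInter] at hx
  exact hinc (fun i => (hx (i.natAbs + 1)).2 i (mem_win i)) (hKB (hx 0).1)

section Domination

variable {ν π : Measure (ZSeq Bool)} [IsProbabilityMeasure ν] [IsProbabilityMeasure π] {s : ℝ}
  (hν : ∀ (a : ℤ) (k : ℕ) (f : ℤ → Bool), f (a + k) = false →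
    ν.real {η | ∀ i ∈ Ico a (a + (k + 1 : ℕ)), η i = f i} ≤
      s * ν.real {η | ∀ i ∈ Ico a (a + k), η i = f i})
  (hπ : ∀ (a : ℤ) (k : ℕ) (f : ℤ → Bool), f (a + k) = false →
    π.real {η | ∀ i ∈ Ico a (a + (k + 1 : ℕ)), η i = f i} =
      s * π.real {η | ∀ i ∈ Ico a (a + k), η i = f i})
include hν hπ

lemma real_le_of_increasing_local (hs0 : 0 ≤ s) (hs1 : s ≤ 1) (a : ℤ) : ∀ (k : ℕ) (C : Set (ZSeq Bool)),
    (∀ x y : ZSeq Bool, (∀ i ∈ Ico a (a + k), x i ≤ y i) → x ∈ C → y ∈ C) → π.real C ≤ ν.real C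
  | 0, C, hC => by
    rcases C.eq_empty_or_nonempty with rfl | ⟨x, hx⟩
    · simp
    · have : C = Set.univ := Set.eq_univ_of_forall fun y => hC x y (by simp) hx
      rw [this, probReal_univ, probReal_univ]
  | k + 1, C, hC => by
    classical
    set Cb : Bool → Set (ZSeq Bool) := fun b => {η | Function.update η (a + k) b ∈ C} with hCb
    have hinc : ∀ b, ∀ x y : ZSeq Bool, (∀ i ∈ Ico a (a + k), x i ≤ y i) → x ∈ Cb b → y ∈ Cb b := by
      intro b x y hxy hx
      refine hC _ _ (fun i hi => ?_) hx
      rcases eq_or_ne i (a + k) with rfl | hne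
      · rw [Function.update_self, Function.update_self]
      · rw [Function.update_of_ne hne, Function.update_of_ne hne]
        rw [mem_Ico] at hi
        push_cast at hi
        exact hxy i (mem_Ico.2 (by omega))
    have hdep : ∀ b, ∀ x y : ZSeq Bool, (∀ i ∈ Ico a (a + k), x i = y i) → x ∈ Cb b → y ∈ Cb b :=
      fun b x y hxy => hinc b x y fun i hi => (hxy i hi).le
    have hsub : Cb false ⊆ Cb true := fun x hx => by
      refine hC _ _ (fun i _ => ?_) hx
      rcases eq_or_ne i (a + k) with rfl | hne
      · rw [Function.update_self, Function.update_self]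
        exact Bool.false_le _
      · rw [Function.update_of_ne hne, Function.update_of_ne hne]
    set E : Set (ZSeq Bool) := {η | η (a + k) = false} with hE
    have hDdep : ∀ x y : ZSeq Bool, (∀ i ∈ Ico a (a + k), x i = y i) →
        x ∈ Cb true \ Cb false → y ∈ Cb true \ Cb false :=
      fun x y hxy hx => ⟨hdep _ x y hxy hx.1, fun hy =>
        hx.2 (hdep _ y x (fun i hi => (hxy i hi).symm) hy)⟩
    have hCeq : C = Cb true \ ((Cb true \ Cb false) ∩ E) := by
      ext η
      have hu : ∀ b, η (a + k) = b → (η ∈ Cb b ↔ η ∈ C) := fun b hb => by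
        rw [hCb, Set.mem_ofPred_eq, ← hb, Function.update_eq_self]
      simp only [Set.mem_sdiff, Set.mem_inter_iff, not_and]
      cases hb : η (a + k) with
      | false =>
        have hbE : η ∈ E := hb
        rw [← hu _ hb]
        exact ⟨fun h => ⟨hsub h, fun h' => absurd h h'.2⟩, fun h => by
          by_contra hcon
          exact h.2 ⟨h.1, hcon⟩ hbE⟩
      | true =>
        have hbE : η ∉ E := fun h => by
          rw [hE, Set.mem_ofPred_eq, hb] at h
          exact absurd h (by decide)
        rw [← hu _ hb]
        exact ⟨fun h => ⟨h, fun _ => hbE⟩, fun h => h.1⟩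
    have hm : ∀ b, MeasurableSet (Cb b) := fun b => measurableSet_of_depends (hdep b)
    have key : ∀ (m : Measure (ZSeq Bool)) [IsProbabilityMeasure m], m.real C =
        m.real (Cb true) - m.real ((Cb true \ Cb false) ∩ E) := by
      intro m _
      conv_lhs => rw [hCeq]
      exact measureReal_sdiff (Set.inter_subset_left.trans Set.sdiff_subset)
        (((hm _).diff (hm _)).inter (measurableSet_minus _))
    have h1 := real_inter_minus_le (hν a k) hDdep
    have h2 := real_inter_minus_eq (hπ a k) hDdep
    rw [measureReal_sdiff hsub (hm _)] at h1 h2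
    have h3 := real_le_of_increasing_local hs0 hs1 a k _ (hinc true)
    have h4 := real_le_of_increasing_local hs0 hs1 a k _ (hinc false)
    rw [key π, key ν, h2]
    nlinarith

/-- A uniform conditional lower bound on plus spins implies domination of a product measure. -/
theorem stochDom_of_conditional (hs0 : 0 ≤ s) (hs1 : s ≤ 1) : StochDom π ν := by
  intro B hB hinc
  rw [hB.measure_eq_iSup_isCompact_of_ne_top (measure_ne_top π B)]
  refine iSup₂_le fun K hKB => iSup_le fun hK => ?_
  have hle : ∀ n, π K ≤ ν (upWin K n) := fun n => by
    have hsub : K ⊆ upWin K n := fun x hx => ⟨x, hx, fun _ _ => le_rfl⟩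
    refine (measure_mono hsub).trans
      (show π (upWin K n) ≤ ν (upWin K n) from ?_)
    have := real_le_of_increasing_local hν hπ hs0 hs1 (-(n : ℤ)) (2 * n) (upWin K n)
      fun x y => upWin_increasing
    rwa [measureReal_def, measureReal_def,
      ENNReal.toReal_le_toReal (measure_ne_top _ _) (measure_ne_top _ _)] at this
  have hmeas : ∀ n, NullMeasurableSet (upWin K n) ν := fun n =>
    (measurableSet_of_depends (T := win n) fun x y hxy => upWin_increasing fun i hi =>
      (hxy i hi).le).nullMeasurableSet
  have hlim := tendsto_measure_iInter_atTop hmeas (upWin_antitone K) ⟨0, measure_ne_top ν _⟩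
  exact (ge_of_tendsto' hlim hle).trans (measure_mono (iInter_upWin_subset hK hKB hinc))

end Domination

lemma measurable_lineProj : Measurable lineProj :=
  measurable_pi_lambda _ fun _ => measurable_pi_apply _

lemma schonmann_real_agree (μ : Measure Cfg2) (a : ℤ) (k : ℕ) (f : ℤ → Bool) :
    (schonmann μ).real {η | ∀ i ∈ Ico a (a + k), η i = f i} = prob μ (seg a k) fun x => f x.1 := by
  rw [schonmann, map_measureReal_apply measurable_lineProj (measurableSet_agree _ _), prob]
  congr 1
  ext η
  simp only [Set.mem_preimage, Set.mem_ofPred_eq, lineProj, mem_Ico]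
  constructor
  · rintro h ⟨i, j⟩ hx
    rw [mem_seg] at hx
    obtain ⟨hx1, rfl⟩ : _ ∧ j = 0 := hx
    exact h i hx1
  · exact fun h i hi => h (i, 0) (mem_seg.2 ⟨hi, rfl⟩)

variable {β : ℝ}

lemma prob_minus_phase {μp μm : Measure Cfg2} (hp : IsPlusPhase β 0 μp) (hm : IsMinusPhase β 0 μm)
    (T : Finset (ℤ × ℤ)) : prob μm T (fun _ => false) = prob μp T plus := by
  have := hp.1
  have := hm.1
  refine tendsto_nhds_unique (tendsto_ev_cyl hm.2 T _) ((tendsto_ev_cyl hp.2 T plus).congr fun n => ?_)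
  conv_rhs => rw [show (fun _ => false : Cfg2) = flip plus from rfl]
  rw [ev_flip]
  exact ev_congr fun ω _ => (cyl_flip T ω).symm

lemma prob_snoc_le {μ : Measure Cfg2} (hp : IsPlusPhase β 0 μ) (hβ : 0 ≤ β) {s : ℝ} (hs : 0 < s)
    (h : ∀ n, prob μ (seg 0 n) (fun _ => false) ≤ s ^ n) (a : ℤ) (k : ℕ) (f : Cfg2)
    (hf : f (a + k, 0) = false) : prob μ (seg a (k + 1)) f ≤ s * prob μ (seg a k) f := by
  have := hp.1
  have h0 := prob_minus_pos hp.2 hβ a k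
  have h1 := prob_snoc_mul_le hp.2 hβ a k f hf
  have h2 := prob_minus_succ_le hp.2 hβ hs h k
  rw [← prob_minus_shift hp.2 hβ a 0, ← prob_minus_shift hp.2 hβ a 0] at h2
  have h3 : 0 ≤ prob μ (seg a k) f := measureReal_nonneg
  nlinarith [mul_le_mul_of_nonneg_left h2 h3]

section Bernoulli

variable {ρ : ℝ} {π : Measure (ZSeq Bool)} (hπ : IsBernoulliProd ρ π)
include hπ

lemma bernoulli_real (hρ : ρ ∈ Set.Ioo (0 : ℝ) 1) (T : Finset ℤ) (f : ℤ → Bool) :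
    π.real {η | ∀ i ∈ T, η i = f i} = ∏ i ∈ T, if f i then ρ else 1 - ρ := by
  rw [measureReal_def, hπ.2, ENNReal.toReal_prod]
  refine prod_congr rfl fun i _ => ENNReal.toReal_ofReal ?_
  split_ifs <;> linarith [hρ.1, hρ.2]

lemma bernoulli_real_snoc (hρ : ρ ∈ Set.Ioo (0 : ℝ) 1) (a : ℤ) (k : ℕ) (f : ℤ → Bool)
    (hf : f (a + k) = false) : π.real {η | ∀ i ∈ Ico a (a + (k + 1 : ℕ)), η i = f i} =
      (1 - ρ) * π.real {η | ∀ i ∈ Ico a (a + k), η i = f i} := by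
  have : Ico a (a + (k + 1 : ℕ)) = insert (a + k : ℤ) (Ico a (a + k)) := by
    ext i
    rw [mem_insert, mem_Ico, mem_Ico]
    omega
  rw [bernoulli_real hπ hρ, bernoulli_real hπ hρ, this, prod_insert (by simp), hf]
  simp

end Bernoulli

lemma not_stochDom_of_lt {ν π : Measure (ZSeq Bool)} [IsProbabilityMeasure ν]
    [IsProbabilityMeasure π] (T : Finset ℤ)
    (h : π.real {η | ∀ i ∈ T, η i = false} < ν.real {η | ∀ i ∈ T, η i = false}) :
    ¬ StochDom π ν := by
  intro hdom
  have hm := measurableSet_agree T fun _ => false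
  have := hdom _ hm.compl fun x y hxy hx hy => hx fun i hi => by
    have h1 := hxy i
    rw [hy i hi] at h1
    exact le_antisymm h1 (Bool.false_le _)
  rw [← ENNReal.toReal_le_toReal (measure_ne_top _ _) (measure_ne_top _ _)] at this
  change π.real _ ≤ ν.real _ at this
  rw [probReal_compl_eq_one_sub hm, probReal_compl_eq_one_sub hm] at this
  linarith

end

end IsingLine

/-- For each `β > β_c` there is `ρ ∈ (0,1)` such that `ν_{β,0}^+`
stochastically dominates the Bernoulli product measure `π_ρ`, while `π_ρ` is not
stochastically dominated by `ν_{β,0}^-`. -/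
theorem schonmann_dominates_bernoulli_minus_does_not
    (β : ℝ) (hβ : betaCrit < β)
    (μp μm : Measure Cfg2) (hμp : IsPlusPhase β 0 μp) (hμm : IsMinusPhase β 0 μm) :
    ∃ ρ ∈ Set.Ioo (0 : ℝ) 1, ∀ π : Measure (ZSeq Bool), IsBernoulliProd ρ π →
      StochDom π (schonmann μp) ∧ ¬ StochDom π (schonmann μm) := by
  have hβ0 : 0 ≤ β := (IsingLine.betaCrit_pos.trans hβ).le
  have := hμp.1
  have := hμm.1
  obtain ⟨s, hs0, hs1, hs, n, hn⟩ := IsingLine.exists_rate hβ hμp.2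
  have hρ : 1 - s ∈ Set.Ioo (0 : ℝ) 1 := ⟨by linarith, by linarith⟩
  refine ⟨1 - s, hρ, fun π hπ => ?_⟩
  have := hπ.1
  have : IsProbabilityMeasure (schonmann μp) :=
    Measure.isProbabilityMeasure_map IsingLine.measurable_lineProj.aemeasurable
  have : IsProbabilityMeasure (schonmann μm) :=
    Measure.isProbabilityMeasure_map IsingLine.measurable_lineProj.aemeasurable
  refine ⟨IsingLine.stochDom_of_conditional (s := s) (fun a k f hf => ?_) (fun a k f hf => ?_)
    hs0.le hs1.le, IsingLine.not_stochDom_of_lt (Finset.Ico (1 : ℤ) (1 + n)) ?_⟩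
  · rw [IsingLine.schonmann_real_agree, IsingLine.schonmann_real_agree]
    exact IsingLine.prob_snoc_le hμp hβ0 hs0 hs a k _ hf
  · simpa using IsingLine.bernoulli_real_snoc hπ hρ a k f hf
  · have h1 := IsingLine.schonmann_real_agree μm 1 n fun _ => false
    have h2 := IsingLine.bernoulli_real hπ hρ (Finset.Ico (1 : ℤ) (1 + n)) fun _ => false
    rw [h1, h2, IsingLine.prob_minus_phase hμp hμm]
    simpa using hn
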